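/- arXiv:1205.3235 — 2 statements merged into one kernel-verified Lean document; each statement's English description precedes it below -/
import Mathlib

section
/- Let (X,d,μ) be a metric space with a σ-finite Borel measure, and suppose that the modules of derivations have index locally bounded by N: for every measurable U ⊆ X with μ(U) > 0, any family of derivations on (U,d,μ|_U) that is linearly independent over L∞(μ|_U) has at most N elements. Then there is a measurable partition X = X_0 ⊔ X_1 ⊔ ⋯ ⊔ X_N ⊔ Ω with μ(Ω) = 0 such that for every i with X_i nonempty, the L∞(μ|_{X_i})-module of derivations on (X_i,d,μ|_{X_i}) is free of rank i: there exist derivations D_1,…,D_i on X_i that are linearly independent over L∞(μ|_{X_i}) and such that every derivation D on X_i can be written as D = Σ_{j=1}^i λ_j·D_j for some measurable μ-essentially bounded λ_1,…,λ_i : X_i → ℝ (meaning Df = Σ_j λ_j·D_j f μ-a.e. on X_i for every bounded Lipschitz f on X_i); for i = 0 this means that the only derivation on X_0 is the zero derivation. -/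
open MeasureTheory Metric Filter Set Topology
open scoped ENNReal NNReal

noncomputable section

/-- `f` is a bounded Lipschitz function. -/
def IsBddLipschitz {X : Type*} [PseudoMetricSpace X] (f : X → ℝ) : Prop :=
  (∃ K : ℝ≥0, LipschitzWith K f) ∧ ∃ M : ℝ, ∀ x, |f x| ≤ M

/-- The global Lipschitz constant of `f`. -/
def glip {X : Type*} [PseudoMetricSpace X] (f : X → ℝ) : ℝ :=
  sInf {K : ℝ | 0 ≤ K ∧ ∀ x y, |f x - f y| ≤ K * dist x y}

/-- `max (sup_X |f|) (global Lipschitz constant of f)`. -/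
def lipNorm {X : Type*} [PseudoMetricSpace X] (f : X → ℝ) : ℝ :=
  max (⨆ x, |f x|) (glip f)

/-- The variation of `f` on the open ball `B(x,r)`:
`varlip f x r = r⁻¹ · sup_{y ∈ B(x,r)} |f x - f y|`. -/
def varlip {X : Type*} [PseudoMetricSpace X] (f : X → ℝ) (x : X) (r : ℝ) : ℝ :=
  r⁻¹ * sSup ((fun y => |f x - f y|) '' ball x r)

/-- The upper variation of `f` at `x` from scale `r` down to `0`:
`Lip f (x,r) = sup_{0 < s ≤ r} varlip f x s`. -/
def bigLipR {X : Type*} [PseudoMetricSpace X] (f : X → ℝ) (x : X) (r : ℝ) : ℝ :=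
  ⨆ s : Ioc (0:ℝ) r, varlip f x s.1

/-- The lower variation of `f` at `x` from scale `r` down to `0`:
`lip f (x,r) = inf_{0 < s ≤ r} varlip f x s`. -/
def smlLipR {X : Type*} [PseudoMetricSpace X] (f : X → ℝ) (x : X) (r : ℝ) : ℝ :=
  ⨅ s : Ioc (0:ℝ) r, varlip f x s.1

/-- The pointwise upper Lipschitz constant
`Lip f (x) = inf_{r>0} sup_{0<s≤r} varlip f x s`. -/
def bigLip {X : Type*} [PseudoMetricSpace X] (f : X → ℝ) (x : X) : ℝ :=
  ⨅ r : Ioi (0:ℝ), bigLipR f x r.1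

/-- The pointwise lower Lipschitz constant
`lip f (x) = sup_{r>0} inf_{0<s≤r} varlip f x s`. -/
def smlLip {X : Type*} [PseudoMetricSpace X] (f : X → ℝ) (x : X) : ℝ :=
  ⨆ r : Ioi (0:ℝ), smlLipR f x r.1

/-- A derivation on the metric measure space `(X,d,μ)`: a linear, bounded operator
from bounded Lipschitz functions to measurable essentially bounded functions that
satisfies the Leibniz rule and is weak* sequentially continuous. -/
structure MDerivation (X : Type*) [PseudoMetricSpace X] [MeasurableSpace X]
    (μ : MeasureTheory.Measure X) where
  D : (X → ℝ) → (X → ℝ)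
  C : ℝ
  C_nonneg : 0 ≤ C
  measurable_D : ∀ f, IsBddLipschitz f → Measurable (D f)
  linear : ∀ (a b : ℝ) (f g : X → ℝ), IsBddLipschitz f → IsBddLipschitz g →
      ∀ᵐ x ∂μ, D (fun y => a * f y + b * g y) x = a * D f x + b * D g x
  bound : ∀ f, IsBddLipschitz f → ∀ᵐ x ∂μ, |D f x| ≤ C * lipNorm f
  leibniz : ∀ f g, IsBddLipschitz f → IsBddLipschitz g →
      ∀ᵐ x ∂μ, D (fun y => f y * g y) x = f x * D g x + g x * D f x
  weakStar : ∀ (F : ℕ → X → ℝ) (f : X → ℝ), (∀ n, IsBddLipschitz (F n)) →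
      IsBddLipschitz f → (∃ B : ℝ, ∀ n, lipNorm (F n) ≤ B) →
      (∀ x, Tendsto (fun n => F n x) atTop (𝓝 (f x))) →
      ∀ g : X → ℝ, Integrable g μ →
        Tendsto (fun n => ∫ x, D (F n) x * g x ∂μ) atTop (𝓝 (∫ x, D f x * g x ∂μ))

/-- The derivations `D_1,…,D_n` are linearly independent over `L∞(μ)`. -/
def LinIndepDer {X : Type*} [PseudoMetricSpace X] [MeasurableSpace X]
    (μ : MeasureTheory.Measure X) {n : ℕ} (Ds : Fin n → MDerivation X μ) : Prop :=
  ∀ lam : Fin n → X → ℝ, (∀ i, Measurable (lam i)) →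
    (∀ i, ∃ M : ℝ, ∀ᵐ x ∂μ, |lam i x| ≤ M) →
    (∀ f, IsBddLipschitz f → ∀ᵐ x ∂μ, (∑ i, lam i x * (Ds i).D f x) = 0) →
    ∀ i, ∀ᵐ x ∂μ, lam i x = 0

/-- The restriction of `μ` to a subset `s`, as a measure on the subtype `s`. -/
def subMeasure {X : Type*} [MeasurableSpace X] (μ : MeasureTheory.Measure X) (s : Set X) :
    MeasureTheory.Measure s :=
  MeasureTheory.Measure.comap Subtype.val μ

/-! ### Bounds on the Lipschitz norm -/

/-- `f` is bounded by `c` and `c`-Lipschitz. -/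
def LipBound {X : Type*} [PseudoMetricSpace X] (c : ℝ) (f : X → ℝ) : Prop :=
  0 ≤ c ∧ (∀ x, |f x| ≤ c) ∧ ∀ x y, |f x - f y| ≤ c * dist x y

section LipBound

variable {X : Type*} [PseudoMetricSpace X] {c c' : ℝ} {f g : X → ℝ}

lemma LipBound.isBddLipschitz (h : LipBound c f) : IsBddLipschitz f :=
  ⟨⟨c.toNNReal, LipschitzWith.of_dist_le_mul fun x y => by
    rw [Real.dist_eq, Real.coe_toNNReal _ h.1]; exact h.2.2 x y⟩, c, h.2.1⟩

lemma LipBound.lipNorm_le (h : LipBound c f) : lipNorm f ≤ c := by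
  refine max_le ?_ (csInf_le ⟨0, fun K hK => hK.1⟩ ⟨h.1, h.2.2⟩)
  rcases isEmpty_or_nonempty X with hX | hX
  · simpa using h.1
  · exact ciSup_le h.2.1

lemma IsBddLipschitz.lipBound (h : IsBddLipschitz f) : LipBound (lipNorm f) f := by
  obtain ⟨⟨K, hK⟩, M, hM⟩ := h
  have hK' : ∀ x y, |f x - f y| ≤ K * dist x y := fun x y => by
    simpa [Real.dist_eq] using hK.dist_le_mul x y
  have hne : {K : ℝ | 0 ≤ K ∧ ∀ x y, |f x - f y| ≤ K * dist x y}.Nonempty := ⟨K, K.2, hK'⟩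
  have hbdd : BddAbove (range fun x => |f x|) := ⟨M, by rintro _ ⟨x, rfl⟩; exact hM x⟩
  refine ⟨le_max_of_le_right (le_csInf hne fun K hK => hK.1),
    fun x => le_max_of_le_left (le_ciSup hbdd x), fun x y => ?_⟩
  refine le_trans ?_ (mul_le_mul_of_nonneg_right (le_max_right _ (glip f)) dist_nonneg)
  rcases (dist_nonneg (x := x) (y := y)).eq_or_lt with h0 | h0
  · have := hK' x y
    rw [← h0, mul_zero] at this ⊢
    exact this
  · rw [← div_le_iff₀ h0]
    exact le_csInf hne fun K hK => by rw [div_le_iff₀ h0]; exact hK.2 x y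

lemma LipBound.mono (h : LipBound c f) (hc : c ≤ c') : LipBound c' f :=
  ⟨h.1.trans hc, fun x => (h.2.1 x).trans hc, fun x y =>
    (h.2.2 x y).trans (mul_le_mul_of_nonneg_right hc dist_nonneg)⟩

lemma LipBound.const_mul (h : LipBound c f) (a : ℝ) : LipBound (|a| * c) fun x => a * f x := by
  refine ⟨mul_nonneg (abs_nonneg a) h.1, fun x => ?_, fun x y => ?_⟩
  · rw [abs_mul]
    exact mul_le_mul_of_nonneg_left (h.2.1 x) (abs_nonneg a)
  · rw [← mul_sub, abs_mul, mul_assoc]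
    exact mul_le_mul_of_nonneg_left (h.2.2 x y) (abs_nonneg a)

lemma LipBound.add (hf : LipBound c f) (hg : LipBound c' g) :
    LipBound (c + c') fun x => f x + g x := by
  refine ⟨add_nonneg hf.1 hg.1, fun x => ?_, fun x y => ?_⟩
  · exact (abs_add_le _ _).trans (add_le_add (hf.2.1 x) (hg.2.1 x))
  · rw [add_sub_add_comm, add_mul]
    exact (abs_add_le _ _).trans (add_le_add (hf.2.2 x y) (hg.2.2 x y))

lemma LipBound.sub (hf : LipBound c f) (hg : LipBound c' g) :
    LipBound (c + c') fun x => f x - g x := by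
  have := hf.add (hg.const_mul (-1))
  simpa [sub_eq_add_neg] using this

lemma LipBound.mul (hf : LipBound c f) (hg : LipBound c' g) :
    LipBound (3 * (c * c')) fun x => f x * g x := by
  have hc := hf.1
  have hc' := hg.1
  refine ⟨by positivity, fun x => ?_, fun x y => ?_⟩
  · rw [abs_mul]
    have := mul_le_mul (hf.2.1 x) (hg.2.1 x) (abs_nonneg _) hc
    nlinarith [mul_nonneg hc hc']
  · have h1 : f x * g x - f y * g y = f x * (g x - g y) + g y * (f x - f y) := by ring
    have h2 := mul_le_mul (hf.2.1 x) (hg.2.2 x y) (abs_nonneg _) hc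
    have h3 := mul_le_mul (hg.2.1 y) (hf.2.2 x y) (abs_nonneg _) hc'
    rw [h1]
    refine (abs_add_le _ _).trans ?_
    rw [abs_mul, abs_mul]
    have h4 : 0 ≤ c * c' * dist x y := by positivity
    linarith

lemma LipBound.zero : LipBound 0 fun _ : X => (0 : ℝ) := by simp [LipBound]

lemma LipBound.restrict (h : LipBound c f) (U : Set X) : LipBound c fun u : U => f u :=
  ⟨h.1, fun x => h.2.1 x, fun x y => h.2.2 x y⟩

lemma IsBddLipschitz.restrict (h : IsBddLipschitz f) (U : Set X) :
    IsBddLipschitz fun u : U => f u :=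
  (h.lipBound.restrict U).isBddLipschitz

/-- Bounded Lipschitz functions extend with the same bound on the Lipschitz norm. -/
lemma LipBound.exists_extension {U : Set X} {f : U → ℝ} (h : LipBound c f) :
    ∃ F : X → ℝ, LipBound c F ∧ ∀ u : U, F u = f u := by
  classical
  let f' : X → ℝ := fun x => if hx : x ∈ U then f ⟨x, hx⟩ else 0
  have hf' : ∀ u : U, f' u = f u := fun u => by simp [f']
  have hL : LipschitzOnWith c.toNNReal f' U := LipschitzOnWith.of_dist_le_mul fun x hx y hy => by
    rw [Real.dist_eq, Real.coe_toNNReal _ h.1, hf' ⟨x, hx⟩, hf' ⟨y, hy⟩]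
    exact h.2.2 ⟨x, hx⟩ ⟨y, hy⟩
  obtain ⟨g, hg, hgU⟩ := hL.extend_real
  refine ⟨fun x => max (min (g x) c) (-c), ⟨h.1, fun x => ?_, fun x y => ?_⟩, fun u => ?_⟩
  · rw [abs_le]
    exact ⟨le_max_right _ _, max_le (min_le_right _ _) (by linarith [h.1])⟩
  · have h1 := hg.dist_le_mul x y
    rw [Real.dist_eq, Real.coe_toNNReal _ h.1] at h1
    have h2 := abs_min_sub_min_le_max (g x) c (g y) c
    rw [sub_self, abs_zero, max_eq_left (abs_nonneg _)] at h2
    exact (abs_max_sub_max_le_abs _ _ _).trans (h2.trans h1)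
  · have h1 : g u = f u := by rw [← hgU u.2, hf' u]
    have h2 := abs_le.1 (h.2.1 u)
    simp only [h1]
    rw [min_eq_left h2.2, max_eq_left h2.1]

open Classical in
/-- An extension of a bounded Lipschitz function with the same Lipschitz norm. -/
def lipExtend (U : Set X) (f : U → ℝ) : X → ℝ :=
  if h : IsBddLipschitz f then h.lipBound.exists_extension.choose else 0

lemma lipBound_lipExtend {U : Set X} {f : U → ℝ} (h : IsBddLipschitz f) :
    LipBound (lipNorm f) (lipExtend U f) := by
  rw [lipExtend, dif_pos h]
  exact h.lipBound.exists_extension.choose_spec.1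

lemma isBddLipschitz_lipExtend {U : Set X} {f : U → ℝ} (h : IsBddLipschitz f) :
    IsBddLipschitz (lipExtend U f) :=
  (lipBound_lipExtend h).isBddLipschitz

lemma lipExtend_apply {U : Set X} {f : U → ℝ} (h : IsBddLipschitz f) {x : X} (hx : x ∈ U) :
    lipExtend U f x = f ⟨x, hx⟩ := by
  rw [lipExtend, dif_pos h]
  exact h.lipBound.exists_extension.choose_spec.2 ⟨x, hx⟩

/-- The soft threshold of `t` at level `h`. -/
def softThreshold (h t : ℝ) : ℝ := max (t - h) 0 - max (-t - h) 0

lemma abs_softThreshold {h : ℝ} (hh : 0 ≤ h) (t : ℝ) :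
    |softThreshold h t| = max (|t| - h) 0 := by
  unfold softThreshold
  grind

lemma abs_softThreshold_sub_self {h : ℝ} (hh : 0 ≤ h) (t : ℝ) :
    |softThreshold h t - t| ≤ h := by
  unfold softThreshold
  grind

lemma softThreshold_zero_left (t : ℝ) : softThreshold 0 t = t := by
  unfold softThreshold
  grind

lemma abs_softThreshold_sub_le (h h' t t' : ℝ) :
    |softThreshold h t - softThreshold h' t'| ≤ 2 * (|t - t'| + |h - h'|) := by
  unfold softThreshold
  have h1 := abs_max_sub_max_le_abs (t - h) (t' - h') 0
  have h2 := abs_max_sub_max_le_abs (-t - h) (-t' - h') 0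
  grind

lemma LipBound.softThreshold (hf : LipBound c f) {h : X → ℝ} (h0 : ∀ x, 0 ≤ h x)
    (hh : ∀ x y, |h x - h y| ≤ c * dist x y) :
    LipBound (4 * c) fun x => softThreshold (h x) (f x) := by
  refine ⟨by linarith [hf.1], fun x => ?_, fun x y => ?_⟩
  · rw [abs_softThreshold (h0 x)]
    have := hf.2.1 x
    exact max_le (by linarith [h0 x, hf.1]) (by linarith [hf.1])
  · have h1 := abs_softThreshold_sub_le (h x) (h y) (f x) (f y)
    linarith [hh x y, hf.2.2 x y]

/-- A sequence of uniformly bounded uniformly Lipschitz functions on `U` that converges pointwise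
to zero extends to such a sequence on the whole space. -/
lemma exists_extension_tendsto_zero {U : Set X} {F : ℕ → U → ℝ} (hF : ∀ n, LipBound c (F n))
    (hlim : ∀ u, Tendsto (fun n => F n u) atTop (𝓝 0)) :
    ∃ G : ℕ → X → ℝ, (∀ n, LipBound (4 * c) (G n)) ∧ (∀ n, ∀ u : U, G n u = F n u) ∧
      ∀ x, Tendsto (fun n => G n x) atTop (𝓝 0) := by
  have hc : 0 ≤ c := (hF 0).1
  rcases U.eq_empty_or_nonempty with rfl | hne
  · exact ⟨fun _ _ => 0, fun n => LipBound.zero.mono (by linarith), fun n u => u.2.elim,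
      fun x => tendsto_const_nhds⟩
  choose H hH hHF using fun n => (hF n).exists_extension
  have hd0 : ∀ x, 0 ≤ c * infDist x U := fun x => mul_nonneg hc infDist_nonneg
  refine ⟨fun n x => softThreshold (c * infDist x U) (H n x),
    fun n => (hH n).softThreshold hd0 fun x y => ?_, fun n u => ?_, fun x => ?_⟩
  · rw [← mul_sub, abs_mul, abs_of_nonneg hc]
    refine mul_le_mul_of_nonneg_left ?_ hc
    simpa [Real.dist_eq] using (lipschitz_infDist_pt U).dist_le_mul x y
  · dsimp only
    rw [infDist_zero_of_mem u.2, mul_zero, softThreshold_zero_left, hHF]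
  · rw [Metric.tendsto_atTop]
    intro ε hε
    have hlt : infDist x U < infDist x U + ε / (2 * (c + 1)) :=
      lt_add_of_pos_right _ (by positivity)
    obtain ⟨u, hu, hxu⟩ := (infDist_lt_iff hne).1 hlt
    obtain ⟨n₀, hn₀⟩ := Metric.tendsto_atTop.1 (hlim ⟨u, hu⟩) (ε / 2) (by positivity)
    refine ⟨n₀, fun n hn => ?_⟩
    have h1 := hn₀ n hn
    rw [Real.dist_eq, sub_zero, ← hHF n ⟨u, hu⟩] at h1
    have h2 := (hH n).2.2 x u
    have h3 : c * dist x u ≤ c * infDist x U + ε / 2 := by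
      calc c * dist x u ≤ c * (infDist x U + ε / (2 * (c + 1))) :=
            mul_le_mul_of_nonneg_left hxu.le hc
        _ = c * infDist x U + (c / (c + 1)) * (ε / 2) := by field_simp
        _ ≤ c * infDist x U + 1 * (ε / 2) := by
            gcongr
            rw [div_le_one (by positivity)]
            linarith
        _ = _ := by ring
    have h4 : |H n x| - |H n u| ≤ |H n x - H n u| := abs_sub_abs_le_abs_sub _ _
    rw [Real.dist_eq, sub_zero, abs_softThreshold (hd0 x)]
    exact max_lt (by simp only at h1; linarith) hε

end LipBound

/-! ### Operations on derivations -/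

namespace MDerivation

section Operations

variable {X : Type*} [PseudoMetricSpace X] [MeasurableSpace X] {μ : Measure X} {c : ℝ}

lemma abs_le_of_lipBound (D : MDerivation X μ) {f : X → ℝ} (hf : LipBound c f) :
    ∀ᵐ x ∂μ, |D.D f x| ≤ D.C * c := by
  filter_upwards [D.bound f hf.isBddLipschitz] with x hx
  exact hx.trans (mul_le_mul_of_nonneg_left hf.lipNorm_le D.C_nonneg)

lemma integrable_mul (D : MDerivation X μ) {f g : X → ℝ} (hf : IsBddLipschitz f)
    (hg : Integrable g μ) : Integrable (fun x => D.D f x * g x) μ :=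
  hg.bdd_mul (D.measurable_D f hf).aestronglyMeasurable (D.bound f hf)

lemma ae_sub (D : MDerivation X μ) {f g : X → ℝ} (hf : IsBddLipschitz f)
    (hg : IsBddLipschitz g) :
    ∀ᵐ x ∂μ, D.D (fun y => f y - g y) x = D.D f x - D.D g x := by
  have h := D.linear 1 (-1) f g hf hg
  simpa [← sub_eq_add_neg] using h

lemma ae_const_mul (D : MDerivation X μ) {f : X → ℝ} (hf : IsBddLipschitz f) (a : ℝ) :
    ∀ᵐ x ∂μ, D.D (fun y => a * f y) x = a * D.D f x := by
  have h := D.linear a 0 f f hf hf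
  simpa using h

lemma exists_zero (X : Type*) [PseudoMetricSpace X] [MeasurableSpace X] (μ : Measure X) :
    ∃ E : MDerivation X μ, (∀ f x, E.D f x = 0) ∧ E.C = 0 :=
  ⟨{ D := fun _ _ => 0
     C := 0
     C_nonneg := le_rfl
     measurable_D := fun _ _ => measurable_const
     linear := by simp
     bound := by simp
     leibniz := by simp
     weakStar := by simp }, fun _ _ => rfl, rfl⟩

lemma exists_add (D E : MDerivation X μ) :
    ∃ S : MDerivation X μ, ∀ f x, S.D f x = D.D f x + E.D f x :=
  ⟨{ D := fun f x => D.D f x + E.D f x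
     C := D.C + E.C
     C_nonneg := add_nonneg D.C_nonneg E.C_nonneg
     measurable_D := fun f hf => (D.measurable_D f hf).add (E.measurable_D f hf)
     linear := fun a b f g hf hg => by
       filter_upwards [D.linear a b f g hf hg, E.linear a b f g hf hg] with x h1 h2
       rw [h1, h2]; ring
     bound := fun f hf => by
       filter_upwards [D.bound f hf, E.bound f hf] with x h1 h2
       rw [add_mul]
       exact (abs_add_le _ _).trans (add_le_add h1 h2)
     leibniz := fun f g hf hg => by
       filter_upwards [D.leibniz f g hf hg, E.leibniz f g hf hg] with x h1 h2
       rw [h1, h2]; ring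
     weakStar := fun F f hF hf hB hlim g hg => by
       have h := (D.weakStar F f hF hf hB hlim g hg).add (E.weakStar F f hF hf hB hlim g hg)
       simp only [← integral_add (D.integrable_mul (hF _) hg) (E.integrable_mul (hF _) hg),
         ← integral_add (D.integrable_mul hf hg) (E.integrable_mul hf hg)] at h
       simpa only [add_mul] using h }, fun _ _ => rfl⟩

lemma exists_smul (D : MDerivation X μ) {lam : X → ℝ} (hm : Measurable lam)
    (hb : ∃ M : ℝ, ∀ᵐ x ∂μ, |lam x| ≤ M) :
    ∃ S : MDerivation X μ, ∀ f x, S.D f x = lam x * D.D f x := by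
  obtain ⟨M, hM⟩ := hb
  exact ⟨
   { D := fun f x => lam x * D.D f x
     C := |M| * D.C
     C_nonneg := mul_nonneg (abs_nonneg M) D.C_nonneg
     measurable_D := fun f hf => hm.mul (D.measurable_D f hf)
     linear := fun a b f g hf hg => by
       filter_upwards [D.linear a b f g hf hg] with x h1
       rw [h1]; ring
     bound := fun f hf => by
       filter_upwards [D.bound f hf, hM] with x h1 h2
       rw [abs_mul, mul_assoc]
       exact mul_le_mul (h2.trans (le_abs_self M)) h1 (abs_nonneg _) (abs_nonneg M)
     leibniz := fun f g hf hg => by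
       filter_upwards [D.leibniz f g hf hg] with x h1
       rw [h1]; ring
     weakStar := fun F f hF hf hB hlim g hg => by
       have h := D.weakStar F f hF hf hB hlim (fun x => lam x * g x)
         (hg.bdd_mul hm.aestronglyMeasurable hM)
       simpa only [mul_assoc, mul_left_comm (lam _)] using h }, fun _ _ => rfl⟩

lemma exists_sum_smul {ι : Type*} (s : Finset ι) (Ds : ι → MDerivation X μ) {lam : ι → X → ℝ}
    (hm : ∀ i, Measurable (lam i)) (hb : ∀ i, ∃ M : ℝ, ∀ᵐ x ∂μ, |lam i x| ≤ M) :
    ∃ S : MDerivation X μ, ∀ f x, S.D f x = ∑ i ∈ s, lam i x * (Ds i).D f x := by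
  classical
  induction s using Finset.induction_on with
  | empty => simpa using (exists_zero X μ).imp fun E hE => hE.1
  | insert a s ha ih =>
    obtain ⟨S, hS⟩ := ih
    obtain ⟨T, hT⟩ := (Ds a).exists_smul (hm a) (hb a)
    obtain ⟨E, hE⟩ := T.exists_add S
    exact ⟨E, fun f x => by rw [hE, hS, hT, Finset.sum_insert ha]⟩

lemma exists_sub_smul (D E : MDerivation X μ) {lam : X → ℝ} (hm : Measurable lam)
    (hb : ∃ M : ℝ, ∀ᵐ x ∂μ, |lam x| ≤ M) :
    ∃ S : MDerivation X μ, ∀ f x, S.D f x = D.D f x - lam x * E.D f x := by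
  obtain ⟨T, hT⟩ := E.exists_smul hm.neg (by simpa using hb)
  obtain ⟨S, hS⟩ := D.exists_add T
  exact ⟨S, fun f x => by rw [hS, hT, Pi.neg_apply]; ring⟩

lemma exists_eq_of_bound (D : MDerivation X μ) (hc : 0 ≤ c)
    (h : ∀ f, IsBddLipschitz f → ∀ᵐ x ∂μ, |D.D f x| ≤ c * lipNorm f) :
    ∃ E : MDerivation X μ, E.D = D.D ∧ E.C = c :=
  ⟨{ D with C := c, C_nonneg := hc, bound := h }, rfl, rfl⟩

/-- A measurable choice among countably many uniformly bounded derivations is a derivation. -/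
lemma exists_glue (Ds : ℕ → MDerivation X μ) (hc : ∀ m, (Ds m).C ≤ c) {n : X → ℕ}
    (hn : Measurable n) : ∃ E : MDerivation X μ, ∀ f x, E.D f x = (Ds (n x)).D f x := by
  have hc0 : 0 ≤ c := (Ds 0).C_nonneg.trans (hc 0)
  have hmeas : ∀ f, IsBddLipschitz f → Measurable fun x => (Ds (n x)).D f x := fun f hf =>
    (measurable_from_prod_countable_right (f := fun p : ℕ × X => (Ds p.1).D f p.2)
      fun m => (Ds m).measurable_D f hf).comp (hn.prodMk measurable_id)
  have hbound : ∀ f, IsBddLipschitz f → ∀ᵐ x ∂μ, |(Ds (n x)).D f x| ≤ c * lipNorm f :=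
    fun f hf => by
      filter_upwards [ae_all_iff.2 fun m => (Ds m).bound f hf] with x hx
      exact (hx (n x)).trans (mul_le_mul_of_nonneg_right (hc _) hf.lipBound.1)
  have hS : ∀ m, MeasurableSet (n ⁻¹' {m}) := fun m => hn (measurableSet_singleton m)
  have hdisj : Pairwise (Function.onFun Disjoint fun m => n ⁻¹' {m}) := fun i j hij =>
    Disjoint.preimage n (by simpa using hij)
  have hU : ⋃ m, n ⁻¹' {m} = univ := by ext; simp
  have hint : ∀ f, IsBddLipschitz f → ∀ g : X → ℝ, Integrable g μ →
      ∫ x, (Ds (n x)).D f x * g x ∂μ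
        = ∑' m, ∫ x, (Ds m).D f x * (n ⁻¹' {m}).indicator g x ∂μ := by
    intro f hf g hg
    have h := hasSum_integral_iUnion hS hdisj (f := fun x => (Ds (n x)).D f x * g x) (μ := μ)
      (hg.bdd_mul (hmeas f hf).aestronglyMeasurable (hbound f hf)).integrableOn
    rw [hU, Measure.restrict_univ] at h
    rw [← h.tsum_eq]
    refine tsum_congr fun m => ?_
    rw [← integral_indicator (hS m)]
    refine integral_congr_ae (ae_of_all _ fun x => ?_)
    by_cases hx : x ∈ n ⁻¹' {m}
    · have : n x = m := hx
      simp [this]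
    · simp [hx]
  exact ⟨
   { D := fun f x => (Ds (n x)).D f x
     C := c
     C_nonneg := hc0
     measurable_D := hmeas
     linear := fun a b f g hf hg => by
       filter_upwards [ae_all_iff.2 fun m => (Ds m).linear a b f g hf hg] with x hx
       exact hx (n x)
     bound := hbound
     leibniz := fun f g hf hg => by
       filter_upwards [ae_all_iff.2 fun m => (Ds m).leibniz f g hf hg] with x hx
       exact hx (n x)
     weakStar := fun F f hF hf hB hlim g hg => by
       simp only [hint _ (hF _) g hg, hint f hf g hg]
       obtain ⟨B, hB'⟩ := hB
       have hsum := hasSum_integral_iUnion hS hdisj (f := fun x => |g x|) (μ := μ)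
         hg.abs.integrableOn
       refine tendsto_tsum_of_dominated_convergence (hsum.summable.mul_left (c * B))
         (fun m => (Ds m).weakStar F f hF hf ⟨B, hB'⟩ hlim _ (hg.indicator (hS m)))
         (Eventually.of_forall fun k m => ?_)
       rw [← integral_indicator (hS m), ← integral_const_mul]
       refine norm_integral_le_of_norm_le ((hg.abs.indicator (hS m)).const_mul _) ?_
       filter_upwards [(Ds m).bound (F k) (hF k)] with x hx
       have h1 : |(Ds m).D (F k) x| ≤ c * B :=
         hx.trans (mul_le_mul (hc m) (hB' k) (hF k).lipBound.1 hc0)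
       by_cases hxm : x ∈ n ⁻¹' {m}
       · simp only [indicator_of_mem hxm, Real.norm_eq_abs, abs_mul]
         exact mul_le_mul_of_nonneg_right h1 (abs_nonneg _)
       · simp [indicator_of_notMem hxm] }, fun _ _ => rfl⟩

/-- Derivations are local: if `f` vanishes on `V`, so does `D f`. -/
lemma ae_eq_zero_of_eq_zero [SigmaFinite μ] (D : MDerivation X μ) {V : Set X}
    (hV : MeasurableSet V) {f : X → ℝ} (hf : IsBddLipschitz f) (h0 : ∀ x ∈ V, f x = 0) :
    ∀ᵐ x ∂μ, x ∈ V → D.D f x = 0 := by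
  have hL := hf.lipBound
  set c := lipNorm f
  let ε : ℕ → ℝ := fun n => 1 / ((n : ℝ) + 1)
  have hε : ∀ n, 0 < ε n := fun n => Nat.one_div_pos_of_nat
  let F : ℕ → X → ℝ := fun n x => softThreshold (ε n) (f x)
  have hF : ∀ n, LipBound (4 * c) (F n) := fun n =>
    hL.softThreshold (fun _ => (hε n).le) fun x y => by
      simpa using mul_nonneg hL.1 dist_nonneg
  let G : ℕ → X → ℝ := fun n x => min (((n : ℝ) + 1) * |f x|) 1
  have hG : ∀ n, IsBddLipschitz (G n) := fun n => by
    have hn : (0 : ℝ) ≤ (n : ℝ) + 1 := by positivity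
    have hM : LipBound (max 1 (((n : ℝ) + 1) * c)) (G n) := by
      refine ⟨le_max_of_le_left zero_le_one, fun x => le_max_of_le_left ?_, fun x y => ?_⟩
      · rw [abs_of_nonneg (le_min (by positivity) zero_le_one)]
        exact min_le_right _ _
      · refine le_trans ?_ (mul_le_mul_of_nonneg_right (le_max_right _ _) dist_nonneg)
        have h1 := abs_min_sub_min_le_max (((n : ℝ) + 1) * |f x|) 1 (((n : ℝ) + 1) * |f y|) 1
        rw [sub_self, abs_zero, max_eq_left (abs_nonneg _), ← mul_sub, abs_mul,
          abs_of_nonneg hn] at h1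
        rw [mul_assoc]
        exact h1.trans (mul_le_mul_of_nonneg_left
          ((abs_abs_sub_abs_le_abs_sub _ _).trans (hL.2.2 x y)) hn)
    exact hM.isBddLipschitz
  have hFG : ∀ n, (fun x => F n x * G n x) = F n := fun n => by
    funext x
    rcases le_or_gt |f x| (ε n) with h | h
    · have : F n x = 0 := by
        rw [← abs_eq_zero, abs_softThreshold (hε n).le]
        exact max_eq_right (by linarith)
      simp [this]
    · have : G n x = 1 := min_eq_right (by
        have := (div_lt_iff₀' (by positivity : (0 : ℝ) < (n : ℝ) + 1)).1 h
        exact this.le)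
      simp [this]
  have hDF : ∀ n, ∀ᵐ x ∂μ, x ∈ V → D.D (F n) x = 0 := fun n => by
    have h := D.leibniz (F n) (G n) (hF n).isBddLipschitz (hG n)
    rw [hFG n] at h
    filter_upwards [h] with x hx hxV
    have h1 : G n x = 0 := by simp [G, h0 x hxV]
    have h2 : F n x = 0 := by
      rw [← abs_eq_zero, abs_softThreshold (hε n).le, h0 x hxV]
      exact max_eq_right (by simpa using (hε n).le)
    rw [hx, h1, h2]
    ring
  have hFlim : ∀ x, Tendsto (fun n => F n x) atTop (𝓝 (f x)) := fun x => by
    rw [tendsto_iff_dist_tendsto_zero]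
    refine squeeze_zero (fun _ => dist_nonneg) (fun n => ?_) tendsto_one_div_add_atTop_nhds_zero_nat
    rw [Real.dist_eq]
    exact abs_softThreshold_sub_self (hε n).le _
  have hmeas := D.measurable_D f hf
  have hzero : V.indicator (D.D f) =ᵐ[μ] 0 := by
    refine ae_eq_zero_of_forall_setIntegral_eq_of_sigmaFinite (fun s hs hμs => ?_)
      fun s hs hμs => ?_
    · refine IntegrableOn.indicator ?_ hV
      exact Measure.integrableOn_of_bounded hμs.ne hmeas.aestronglyMeasurable
        (ae_restrict_of_ae (D.bound f hf))
    · have hg : Integrable ((s ∩ V).indicator fun _ => (1 : ℝ)) μ := by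
        rw [integrable_indicator_iff (hs.inter hV)]
        exact integrableOn_const ((measure_mono inter_subset_left).trans_lt hμs).ne
      have hlim := D.weakStar F f (fun n => (hF n).isBddLipschitz) hf
        ⟨4 * c, fun n => (hF n).lipNorm_le⟩ hFlim _ hg
      have hz : ∀ n, ∫ x, D.D (F n) x * (s ∩ V).indicator (fun _ => (1 : ℝ)) x ∂μ = 0 :=
        fun n => by
          refine integral_eq_zero_of_ae ?_
          filter_upwards [hDF n] with x hx
          by_cases hxV : x ∈ s ∩ V
          · simp [hx hxV.2]
          · simp [indicator_of_notMem hxV]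
      simp only [hz] at hlim
      rw [← integral_indicator hs, indicator_indicator]
      refine Eq.trans ?_ (tendsto_nhds_unique hlim tendsto_const_nhds)
      refine integral_congr_ae (ae_of_all _ fun x => ?_)
      by_cases hxV : x ∈ s ∩ V
      · simp [hxV.1, hxV.2]
      · simp only [indicator_of_notMem hxV, mul_zero]
  filter_upwards [hzero] with x hx hxV
  simpa [hxV] using hx

lemma ae_eq_of_eqOn [SigmaFinite μ] (D : MDerivation X μ) {V : Set X} (hV : MeasurableSet V)
    {f g : X → ℝ} (hf : IsBddLipschitz f) (hg : IsBddLipschitz g) (h : ∀ x ∈ V, f x = g x) :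
    ∀ᵐ x ∂μ, x ∈ V → D.D f x = D.D g x := by
  filter_upwards [D.ae_sub hf hg, D.ae_eq_zero_of_eq_zero hV
    (hf.lipBound.sub hg.lipBound).isBddLipschitz fun x hx => sub_eq_zero.2 (h x hx)]
    with x h1 h2 hxV
  exact sub_eq_zero.1 (h1 ▸ h2 hxV)

end Operations

end MDerivation

/-! ### Derivations on subsets -/

section ZeroExtend

variable {X : Type*} {U : Set X}

open Classical in
/-- Extension by zero from a subset. -/
def zeroExtend (U : Set X) (g : U → ℝ) (x : X) : ℝ := if h : x ∈ U then g ⟨x, h⟩ else 0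

lemma zeroExtend_of_mem {g : U → ℝ} {x : X} (h : x ∈ U) : zeroExtend U g x = g ⟨x, h⟩ :=
  dif_pos h

lemma zeroExtend_of_notMem {g : U → ℝ} {x : X} (h : x ∉ U) : zeroExtend U g x = 0 :=
  dif_neg h

lemma zeroExtend_coe (g : U → ℝ) (u : U) : zeroExtend U g u = g u :=
  zeroExtend_of_mem u.2

variable [MeasurableSpace X] {μ : Measure X}

lemma ae_subMeasure_iff (hU : MeasurableSet U) {p : U → Prop} :
    (∀ᵐ u ∂subMeasure μ U, p u) ↔ ∀ᵐ x ∂μ, ∀ h : x ∈ U, p ⟨x, h⟩ := by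
  have h := (MeasurableEmbedding.subtype_coe hU).ae_map_iff (μ := subMeasure μ U)
    (p := fun x => ∀ h : x ∈ U, p ⟨x, h⟩)
  rw [subMeasure, map_comap_subtype_coe hU, ae_restrict_iff' hU] at h
  rw [subMeasure]
  refine Iff.trans ?_ (h.symm.trans ?_)
  · simp
  · exact eventually_congr (Eventually.of_forall fun x => ⟨fun h hx => h hx hx, fun h _ hx => h hx⟩)

lemma integrable_subMeasure_iff (hU : MeasurableSet U) {g : X → ℝ} :
    Integrable (fun u : U => g u) (subMeasure μ U) ↔ IntegrableOn g U μ := by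
  have h := (MeasurableEmbedding.subtype_coe hU).integrable_map_iff (μ := subMeasure μ U) (g := g)
  rw [subMeasure, map_comap_subtype_coe hU] at h
  exact h.symm

lemma integral_subMeasure (hU : MeasurableSet U) (g : X → ℝ) :
    ∫ u : U, g u ∂subMeasure μ U = ∫ x in U, g x ∂μ :=
  integral_subtype_comap hU g

lemma measurable_zeroExtend (hU : MeasurableSet U) {g : U → ℝ} (hg : Measurable g) :
    Measurable (zeroExtend U g) := by
  classical
  exact Measurable.dite (s := U) (f := g) (g := fun _ => 0) hg measurable_const hU

lemma integrable_zeroExtend (hU : MeasurableSet U) {g : U → ℝ}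
    (hg : Integrable g (subMeasure μ U)) : Integrable (zeroExtend U g) μ := by
  have h : IntegrableOn (zeroExtend U g) U μ := by
    rw [← integrable_subMeasure_iff hU]
    simpa only [zeroExtend_coe] using hg
  exact h.integrable_of_forall_notMem_eq_zero fun x hx => zeroExtend_of_notMem hx

end ZeroExtend

namespace MDerivation

variable {X : Type*} [PseudoMetricSpace X] [MeasurableSpace X] {μ : Measure X} {U : Set X}

/-- A derivation on a measurable subset extends by zero. -/
lemma exists_zeroExtend (hU : MeasurableSet U) (D : MDerivation U (subMeasure μ U)) :
    ∃ E : MDerivation X μ, ∀ f, E.D f = zeroExtend U (D.D fun u => f u) := by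
  have hae : ∀ {p : X → Prop}, (∀ x ∉ U, p x) → (∀ᵐ u : U ∂subMeasure μ U, p u) →
      ∀ᵐ x ∂μ, p x := fun {p} h1 h2 => by
    filter_upwards [(ae_subMeasure_iff hU).1 h2] with x hx
    by_cases h : x ∈ U
    · exact hx h
    · exact h1 x h
  have hint : ∀ f g : X → ℝ, ∫ x, zeroExtend U (D.D fun u => f u) x * g x ∂μ
      = ∫ u : U, D.D (fun u => f u) u * g u ∂subMeasure μ U := fun f g => by
    have h := integral_subMeasure (μ := μ) hU fun x => zeroExtend U (D.D fun u => f u) x * g x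
    simp only [zeroExtend_coe] at h
    rw [h, setIntegral_eq_integral_of_forall_compl_eq_zero]
    intro x hx
    rw [zeroExtend_of_notMem hx, zero_mul]
  exact ⟨
   { D := fun f => zeroExtend U (D.D fun u => f u)
     C := D.C
     C_nonneg := D.C_nonneg
     measurable_D := fun f hf => measurable_zeroExtend hU (D.measurable_D _ (hf.restrict U))
     linear := fun a b f g hf hg => by
       refine hae (fun x hx => by simp [zeroExtend_of_notMem hx]) ?_
       simpa only [zeroExtend_coe] using D.linear a b _ _ (hf.restrict U) (hg.restrict U)
     bound := fun f hf => by
       refine hae (fun x hx => ?_) ?_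
       · rw [zeroExtend_of_notMem hx, abs_zero]
         exact mul_nonneg D.C_nonneg hf.lipBound.1
       · simpa only [zeroExtend_coe] using D.abs_le_of_lipBound (hf.lipBound.restrict U)
     leibniz := fun f g hf hg => by
       refine hae (fun x hx => by simp [zeroExtend_of_notMem hx]) ?_
       simpa only [zeroExtend_coe] using D.leibniz _ _ (hf.restrict U) (hg.restrict U)
     weakStar := fun F f hF hf hB hlim g hg => by
       simp only [hint]
       obtain ⟨B, hB⟩ := hB
       exact D.weakStar _ _ (fun n => (hF n).restrict U) (hf.restrict U)
         ⟨B, fun n => ((hF n).lipBound.restrict U).lipNorm_le.trans (hB n)⟩ (fun u => hlim u) _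
         ((integrable_subMeasure_iff hU).2 hg.integrableOn) }, fun _ => rfl⟩

/-- A derivation restricts to every measurable subset. -/
lemma exists_restrict [SigmaFinite μ] (D : MDerivation X μ) (hU : MeasurableSet U) :
    ∃ R : MDerivation U (subMeasure μ U), ∀ f : X → ℝ, IsBddLipschitz f →
      ∀ᵐ x ∂μ, ∀ h : x ∈ U, R.D (fun u => f u) ⟨x, h⟩ = D.D f x := by
  have hloc : ∀ {f : U → ℝ} {F : X → ℝ}, IsBddLipschitz f → IsBddLipschitz F →
      (∀ u : U, F u = f u) → ∀ᵐ x ∂μ, x ∈ U → D.D (lipExtend U f) x = D.D F x :=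
    fun {f F} hf hF h => D.ae_eq_of_eqOn hU (isBddLipschitz_lipExtend hf) hF fun x hx => by
      rw [lipExtend_apply hf hx, h ⟨x, hx⟩]
  refine ⟨
   { D := fun f u => D.D (lipExtend U f) u
     C := D.C
     C_nonneg := D.C_nonneg
     measurable_D := fun f hf =>
       (D.measurable_D _ (isBddLipschitz_lipExtend hf)).comp measurable_subtype_coe
     linear := fun a b f g hf hg => ?_
     bound := fun f hf => ?_
     leibniz := fun f g hf hg => ?_
     weakStar := fun F f hF hf hB hlim g hg => ?_ }, fun f hf => ?_⟩
  · rw [ae_subMeasure_iff hU]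
    have hf' := isBddLipschitz_lipExtend hf
    have hg' := isBddLipschitz_lipExtend hg
    filter_upwards [D.linear a b _ _ hf' hg', hloc
      ((hf.lipBound.const_mul a).add (hg.lipBound.const_mul b)).isBddLipschitz
      ((hf'.lipBound.const_mul a).add (hg'.lipBound.const_mul b)).isBddLipschitz
      fun u => by rw [lipExtend_apply hf u.2, lipExtend_apply hg u.2]] with x h1 h2 hx
    rw [h2 hx, h1]
  · rw [ae_subMeasure_iff hU]
    filter_upwards [D.abs_le_of_lipBound (lipBound_lipExtend hf)] with x h1 hx
    exact h1
  · rw [ae_subMeasure_iff hU]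
    have hf' := isBddLipschitz_lipExtend hf
    have hg' := isBddLipschitz_lipExtend hg
    filter_upwards [D.leibniz _ _ hf' hg', hloc (hf.lipBound.mul hg.lipBound).isBddLipschitz
      (hf'.lipBound.mul hg'.lipBound).isBddLipschitz
      fun u => by rw [lipExtend_apply hf u.2, lipExtend_apply hg u.2]] with x h1 h2 hx
    rw [h2 hx, h1, lipExtend_apply hf hx, lipExtend_apply hg hx]
  · obtain ⟨B, hB⟩ := hB
    have hf' := isBddLipschitz_lipExtend hf
    have hF' := fun n => isBddLipschitz_lipExtend (hF n)
    obtain ⟨G, hG, hGF, hG0⟩ := exists_extension_tendsto_zero (c := B + lipNorm f)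
      (F := fun n u => F n u - f u)
      (fun n => ((hF n).lipBound.mono (hB n)).sub hf.lipBound)
      (fun u => by simpa using (hlim u).sub_const (f u))
    have hg' := integrable_zeroExtend hU hg
    have hint : ∀ h : X → ℝ, ∫ u : U, D.D h u * g u ∂subMeasure μ U
        = ∫ x, D.D h x * zeroExtend U g x ∂μ := fun h => by
      have := integral_subMeasure (μ := μ) hU fun x => D.D h x * zeroExtend U g x
      simp only [zeroExtend_coe] at this
      rw [this, setIntegral_eq_integral_of_forall_compl_eq_zero]
      intro x hx
      rw [zeroExtend_of_notMem hx, mul_zero]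
    have hz := D.weakStar G (fun _ => 0) (fun n => (hG n).isBddLipschitz)
      LipBound.zero.isBddLipschitz ⟨_, fun n => (hG n).lipNorm_le⟩ hG0 _ hg'
    have hz0 : ∫ x, D.D (fun _ => 0) x * zeroExtend U g x ∂μ = 0 := by
      refine integral_eq_zero_of_ae ?_
      filter_upwards [D.abs_le_of_lipBound LipBound.zero] with x hx
      have : D.D (fun _ => 0) x = 0 := by simpa using hx
      simp [this]
    rw [hz0] at hz
    have hdiff : ∀ n, ∫ x, D.D (G n) x * zeroExtend U g x ∂μ
        = ∫ x, D.D (lipExtend U (F n)) x * zeroExtend U g x ∂μ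
          - ∫ x, D.D (lipExtend U f) x * zeroExtend U g x ∂μ := fun n => by
      rw [← integral_sub (D.integrable_mul (hF' n) hg') (D.integrable_mul hf' hg')]
      refine integral_congr_ae ?_
      filter_upwards [D.ae_sub (hF' n) hf', D.ae_eq_of_eqOn hU (hG n).isBddLipschitz
        ((hF' n).lipBound.sub hf'.lipBound).isBddLipschitz fun x hx => by
          rw [hGF n ⟨x, hx⟩, lipExtend_apply (hF n) hx, lipExtend_apply hf hx]] with x h1 h2
      by_cases hx : x ∈ U
      · rw [h2 hx, h1, sub_mul]
      · simp [zeroExtend_of_notMem hx]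
    simp only [hint]
    simp only [hdiff] at hz
    simpa using hz.add_const (∫ x, D.D (lipExtend U f) x * zeroExtend U g x ∂μ)
  · filter_upwards [hloc (hf.restrict U) hf fun u => rfl] with x hx h
    exact hx h

end MDerivation

/-! ### Frames -/

/-- There is a countable union of measurable sets with property `P` such that every measurable set
with property `P` that is disjoint from it is null. -/
lemma exists_seq_maximal {X : Type*} [MeasurableSpace X] (μ : Measure X) [SFinite μ]
    {P : Set X → Prop} (hP : P ∅) :
    ∃ A : ℕ → Set X, (∀ n, MeasurableSet (A n)) ∧ (∀ n, P (A n)) ∧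
      ∀ V, MeasurableSet V → P V → Disjoint V (⋃ n, A n) → μ V = 0 := by
  let ν := μ.toFinite
  let S : Set ℝ≥0∞ := {r | ∃ A : ℕ → Set X,
    (∀ n, MeasurableSet (A n)) ∧ (∀ n, P (A n)) ∧ ν (⋃ n, A n) = r}
  have hS : S.Nonempty := ⟨_, fun _ => ∅, fun _ => MeasurableSet.empty, fun _ => hP, rfl⟩
  obtain ⟨u, -, hu, huS⟩ := exists_seq_tendsto_sSup hS (OrderTop.bddAbove S)
  choose A hAm hAP hAu using huS
  let B : ℕ → Set X := fun k => A k.unpair.1 k.unpair.2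
  have hle : sSup S ≤ ν (⋃ k, B k) := le_of_tendsto' hu fun n => by
    rw [← hAu n]
    refine measure_mono (iUnion_subset fun m => ?_)
    have : A n m = B (Nat.pair n m) := by simp [B]
    rw [this]
    exact subset_iUnion B _
  refine ⟨B, fun k => hAm _ _, fun k => hAP _ _, fun V hV hPV hdisj => ?_⟩
  have hmem : ν (V ∪ ⋃ k, B k) ∈ S := by
    refine ⟨fun k => Nat.casesOn k V B, fun k => ?_, fun k => ?_, ?_⟩
    · cases k
      · exact hV
      · exact hAm _ _
    · cases k
      · exact hPV
      · exact hAP _ _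
    · exact congrArg ν (union_iUnion_nat_succ fun k => Nat.casesOn k V B).symm
  have h := (le_sSup hmem).trans hle
  rw [measure_union hdisj (MeasurableSet.iUnion fun k => hAm _ _)] at h
  have h0 : ν V = 0 := by
    have h1 : ν V + ν (⋃ k, B k) ≤ 0 + ν (⋃ k, B k) := by simpa using h
    simpa using (ENNReal.add_le_add_iff_right (measure_ne_top ν _)).1 h1
  exact absolutelyContinuous_toFinite μ h0

lemma linIndepDer_of_dual {X : Type*} [PseudoMetricSpace X] [MeasurableSpace X] {μ : Measure X}
    {i : ℕ} {Ds : Fin i → MDerivation X μ} (n : X → ℕ) {fs : ℕ → Fin i → X → ℝ}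
    (hfs : ∀ m k, IsBddLipschitz (fs m k))
    (h : ∀ m j k, ∀ᵐ x ∂μ, n x = m → (Ds j).D (fs m k) x = if j = k then 1 else 0) :
    LinIndepDer μ Ds := by
  intro lam _ _ hlam k
  filter_upwards [ae_all_iff.2 fun m => hlam (fs m k) (hfs m k),
    ae_all_iff.2 fun m => ae_all_iff.2 fun j => h m j k] with x h1 h2
  have h3 := h1 (n x)
  simpa [h2 (n x) _ rfl] using h3

section Frame

variable {X : Type*} [PseudoMetricSpace X] [MeasurableSpace X] {μ : Measure X} {i : ℕ}

/-- Derivations with a uniform bound that are dual to functions of Lipschitz norm at most one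
almost everywhere on `A`. -/
structure IsFrame (Ds : Fin i → MDerivation X μ) (fs : Fin i → X → ℝ) (A : Set X) : Prop where
  C_le : ∀ j, (Ds j).C ≤ 3 ^ i
  lipBound : ∀ k, LipBound 1 (fs k)
  dual : ∀ j k, ∀ᵐ x ∂μ, x ∈ A → (Ds j).D (fs k) x = if j = k then 1 else 0

/-- The set `A` carries a frame of size `i`. -/
def HasFrame (μ : Measure X) (i : ℕ) (A : Set X) : Prop :=
  ∃ (Ds : Fin i → MDerivation X μ) (fs : Fin i → X → ℝ), IsFrame Ds fs A

lemma hasFrame_empty (μ : Measure X) (i : ℕ) : HasFrame μ i ∅ := by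
  obtain ⟨Z, -, hZ⟩ := MDerivation.exists_zero X μ
  exact ⟨fun _ => Z, fun _ _ => 0, fun _ => by rw [hZ]; positivity,
    fun _ => LipBound.zero.mono zero_le_one, by simp⟩

lemma hasFrame_zero (μ : Measure X) (A : Set X) : HasFrame μ 0 A :=
  ⟨Fin.elim0, Fin.elim0, fun j => j.elim0, fun j => j.elim0, fun j => j.elim0⟩

/-- A derivation that does not vanish on `A` almost attains its norm, on some non-null subset,
at a single function of Lipschitz norm at most one. -/
lemma MDerivation.exists_almost_norming (D : MDerivation X μ) {A : Set X} (hA : MeasurableSet A)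
    {g : X → ℝ} (hg : IsBddLipschitz g) (hne : ¬ ∀ᵐ x ∂μ, x ∈ A → D.D g x = 0) :
    ∃ (c : ℝ) (h : X → ℝ) (V : Set X), 0 < c ∧ LipBound 1 h ∧ V ⊆ A ∧ MeasurableSet V ∧
      μ V ≠ 0 ∧ (∀ x ∈ V, c / 2 < |D.D h x|) ∧
      ∀ f, IsBddLipschitz f → ∀ᵐ x ∂μ, x ∈ A → |D.D f x| ≤ c * lipNorm f := by
  let S : Set ℝ := {c | 0 ≤ c ∧
    ∀ f, IsBddLipschitz f → ∀ᵐ x ∂μ, x ∈ A → |D.D f x| ≤ c * lipNorm f}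
  have hCS : D.C ∈ S := ⟨D.C_nonneg, fun f hf => (D.bound f hf).mono fun x hx _ => hx⟩
  have hpos : 0 < sInf S := by
    obtain ⟨δ, hδ, hδg⟩ : ∃ δ > 0, ¬ ∀ᵐ x ∂μ, x ∈ A → |D.D g x| ≤ δ := by
      by_contra! hcon
      refine hne ?_
      filter_upwards [ae_all_iff.2 fun n : ℕ =>
        hcon (1 / ((n : ℝ) + 1)) Nat.one_div_pos_of_nat] with x hx hxA
      rw [← abs_eq_zero]
      exact le_antisymm (ge_of_tendsto' tendsto_one_div_add_atTop_nhds_zero_nat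
        fun n => hx n hxA) (abs_nonneg _)
    have hLg := hg.lipBound.1
    refine lt_of_lt_of_le (b := δ / (lipNorm g + 1)) (by positivity) (le_csInf ⟨_, hCS⟩ ?_)
    intro c hc
    by_contra! hlt
    rw [lt_div_iff₀ (by positivity)] at hlt
    refine hδg ((hc.2 g hg).mono fun x hx hxA => (hx hxA).trans ?_)
    nlinarith [hc.1]
  obtain ⟨c, hcS, hc⟩ := exists_lt_of_csInf_lt ⟨_, hCS⟩ (show sInf S < 2 * sInf S by linarith)
  have hc0 : 0 < c := hpos.trans_le (csInf_le ⟨0, fun _ h => h.1⟩ hcS)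
  have hcn : c / 2 ∉ S := notMem_of_lt_csInf (by linarith) ⟨0, fun _ h => h.1⟩
  obtain ⟨f, hf, hfc⟩ : ∃ f, IsBddLipschitz f ∧
      ¬ ∀ᵐ x ∂μ, x ∈ A → |D.D f x| ≤ c / 2 * lipNorm f := by
    by_contra! hcon
    exact hcn ⟨by positivity, hcon⟩
  have hL : 0 < lipNorm f := by
    refine lt_of_le_of_ne hf.lipBound.1 fun h0 => hfc ?_
    filter_upwards [D.bound f hf] with x hx _
    rwa [← h0, mul_zero] at hx ⊢
  have hh : LipBound 1 fun x => (lipNorm f)⁻¹ * f x := by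
    have := hf.lipBound.const_mul (lipNorm f)⁻¹
    rwa [abs_of_pos (inv_pos.2 hL), inv_mul_cancel₀ hL.ne'] at this
  refine ⟨c, _, A ∩ {x | c / 2 < |D.D (fun x => (lipNorm f)⁻¹ * f x) x|}, hc0, hh,
    inter_subset_left, hA.inter (measurableSet_lt measurable_const
      (D.measurable_D _ hh.isBddLipschitz).abs), fun h0 => hfc ?_, fun x hx => hx.2, hcS.2⟩
  filter_upwards [measure_eq_zero_iff_ae_notMem.1 h0, D.ae_const_mul hf (lipNorm f)⁻¹]
    with x h1 h2 hxA
  have h3 : |D.D (fun x => (lipNorm f)⁻¹ * f x) x| ≤ c / 2 := not_lt.1 fun h => h1 ⟨hxA, h⟩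
  rw [h2, abs_mul, abs_of_pos (inv_pos.2 hL), inv_mul_le_iff₀ hL] at h3
  linarith

/-- A frame on `A` can be enlarged on a non-null subset by means of a derivation that annihilates
the dual functions but does not vanish on `A`. -/
lemma IsFrame.exists_hasFrame_succ {Ds : Fin i → MDerivation X μ} {fs : Fin i → X → ℝ} {A : Set X}
    (hF : IsFrame Ds fs A) (hA : MeasurableSet A) (D : MDerivation X μ)
    (hD : ∀ k, ∀ᵐ x ∂μ, x ∈ A → D.D (fs k) x = 0) {g : X → ℝ} (hg : IsBddLipschitz g)
    (hne : ¬ ∀ᵐ x ∂μ, x ∈ A → D.D g x = 0) :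
    ∃ V ⊆ A, MeasurableSet V ∧ μ V ≠ 0 ∧ HasFrame μ (i + 1) V := by
  obtain ⟨c, h, V, hc, hh, hVA, hV, hμV, hVh, hbd⟩ := D.exists_almost_norming hA hg hne
  have hhL := hh.isBddLipschitz
  refine ⟨V, hVA, hV, hμV, ?_⟩
  have hmeas : Measurable (V.indicator fun x => (D.D h x)⁻¹) :=
    (D.measurable_D h hhL).inv.indicator hV
  have hlam : ∀ x, |V.indicator (fun x => (D.D h x)⁻¹) x| ≤ 2 / c := fun x => by
    by_cases hx : x ∈ V
    · rw [indicator_of_mem hx, abs_inv, inv_le_comm₀ (lt_trans (by positivity) (hVh x hx))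
        (by positivity), inv_div]
      exact (hVh x hx).le
    · rw [indicator_of_notMem hx, abs_zero]
      positivity
  obtain ⟨E₀, hE₀⟩ := D.exists_smul hmeas ⟨2 / c, ae_of_all _ hlam⟩
  obtain ⟨E, hEE₀, hEC⟩ := E₀.exists_eq_of_bound zero_le_two fun f hf => by
    filter_upwards [hbd f hf] with x hx
    rw [hE₀, abs_mul]
    by_cases hxV : x ∈ V
    · calc _ ≤ 2 / c * (c * lipNorm f) :=
            mul_le_mul (hlam x) (hx (hVA hxV)) (abs_nonneg _) (by positivity)
        _ = 2 * lipNorm f := by field_simp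
    · rw [indicator_of_notMem hxV, abs_zero, zero_mul]
      exact mul_nonneg zero_le_two hf.lipBound.1
  have hE : ∀ f x, E.D f x = V.indicator (fun x => (D.D h x)⁻¹) x * D.D f x := fun f x => by
    rw [hEE₀, hE₀]
  have hEh : ∀ x ∈ V, E.D h x = 1 := fun x hx => by
    rw [hE, indicator_of_mem hx]
    exact inv_mul_cancel₀ (abs_pos.1 (lt_trans (by positivity) (hVh x hx)))
  have hEf : ∀ k, ∀ᵐ x ∂μ, x ∈ A → E.D (fs k) x = 0 := fun k => by
    filter_upwards [hD k] with x hx hxA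
    rw [hE, hx hxA, mul_zero]
  have hT : ∀ j, ∃ T : MDerivation X μ,
      (∀ f x, T.D f x = (Ds j).D f x - (Ds j).D h x * E.D f x) ∧ T.C = 3 ^ (i + 1) := fun j => by
    obtain ⟨T₀, hT₀⟩ := (Ds j).exists_sub_smul E ((Ds j).measurable_D h hhL)
      ⟨_, (Ds j).abs_le_of_lipBound hh⟩
    obtain ⟨T, hTT₀, hTC⟩ := T₀.exists_eq_of_bound (c := 3 ^ (i + 1)) (by positivity)
      fun f hf => by
        filter_upwards [(Ds j).bound f hf, (Ds j).abs_le_of_lipBound hh, E.bound f hf]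
          with x h1 h2 h3
        have hL := hf.lipBound.1
        rw [hEC] at h3
        have h4 : |(Ds j).D f x| ≤ 3 ^ i * lipNorm f :=
          h1.trans (mul_le_mul_of_nonneg_right (hF.C_le j) hL)
        have h5 : |(Ds j).D h x| * |E.D f x| ≤ 3 ^ i * (2 * lipNorm f) :=
          mul_le_mul (h2.trans (by simpa using hF.C_le j)) h3 (abs_nonneg _) (by positivity)
        rw [hT₀]
        refine (abs_sub _ _).trans ?_
        rw [abs_mul, pow_succ]
        linarith
    exact ⟨T, fun f x => by rw [hTT₀, hT₀], hTC⟩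
  choose T hT hTC using hT
  refine ⟨Fin.cons E T, Fin.cons h fs, ?_, ?_, ?_⟩
  · refine Fin.forall_fin_succ.2 ⟨?_, fun j => ?_⟩
    · rw [Fin.cons_zero, hEC, pow_succ]
      linarith [one_le_pow₀ (n := i) (show (1 : ℝ) ≤ 3 by norm_num)]
    · rw [Fin.cons_succ, hTC]
  · exact Fin.forall_fin_succ.2 ⟨by simpa using hh, fun k => by simpa using hF.lipBound k⟩
  · refine Fin.forall_fin_succ.2 ⟨Fin.forall_fin_succ.2 ⟨?_, fun k => ?_⟩,
      fun j => Fin.forall_fin_succ.2 ⟨?_, fun k => ?_⟩⟩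
    · simpa using ae_of_all μ hEh
    · filter_upwards [hEf k] with x hx hxV
      simpa [(Fin.succ_ne_zero k).symm] using hx (hVA hxV)
    · refine ae_of_all _ fun x hx => ?_
      simp [hT, hEh x hx]
    · filter_upwards [hEf k, hF.dual j k] with x h1 h2 hxV
      simp [hT, h1 (hVA hxV), h2 (hVA hxV)]

/-- If `U` is covered by countably many sets with frames of size `i`, and no non-null subset of
`U` carries a frame of size `i + 1`, then the derivations on `U` form a free module of rank `i`. -/
lemma exists_basis_of_hasFrame [SigmaFinite μ] {A : ℕ → Set X} (hA : ∀ m, MeasurableSet (A m))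
    (hAF : ∀ m, HasFrame μ i (A m)) {U : Set X} (hU : MeasurableSet U) (hUA : U ⊆ ⋃ m, A m)
    (hmax : ∀ V ⊆ U, MeasurableSet V → HasFrame μ (i + 1) V → μ V = 0) :
    ∃ Rs : Fin i → MDerivation U (subMeasure μ U), LinIndepDer (subMeasure μ U) Rs ∧
      ∀ D : MDerivation U (subMeasure μ U), ∃ lam : Fin i → U → ℝ,
        (∀ j, Measurable (lam j)) ∧ (∀ j, ∃ B : ℝ, ∀ᵐ x ∂subMeasure μ U, |lam j x| ≤ B) ∧
        ∀ f : U → ℝ, IsBddLipschitz f →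
          ∀ᵐ x ∂subMeasure μ U, D.D f x = ∑ j, lam j x * (Rs j).D f x := by
  classical
  choose Ds fs hF using hAF
  have hfsL := fun m k => ((hF m).lipBound k).isBddLipschitz
  have hex : ∀ x, ∃ m, x ∈ A m ∨ x ∉ ⋃ m, A m := fun x => by
    by_cases hx : x ∈ ⋃ m, A m
    · exact (mem_iUnion.1 hx).imp fun m hm => Or.inl hm
    · exact ⟨0, Or.inr hx⟩
  let n : X → ℕ := fun x => Nat.find (hex x)
  have hn : Measurable n := measurable_find hex fun k =>
    (hA k).union (MeasurableSet.iUnion hA).compl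
  have hnA : ∀ x ∈ U, x ∈ A (n x) := fun x hx =>
    (Nat.find_spec (hex x)).resolve_right fun h => h (hUA hx)
  choose G hG using fun j => MDerivation.exists_glue (fun m => Ds m j) (fun m => (hF m).C_le j) hn
  choose Rs hRs using fun j => (G j).exists_restrict hU
  refine ⟨Rs, ?_, fun D => ?_⟩
  · refine linIndepDer_of_dual (fun u => n u) (fun m k => (hfsL m k).restrict U) fun m j k => ?_
    rw [ae_subMeasure_iff hU]
    filter_upwards [hRs j _ (hfsL m k), (hF m).dual j k] with x h1 h2 hxU hnx
    rw [h1 hxU, hG]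
    rw [hnx]
    exact h2 (hnx ▸ hnA x hxU)
  · obtain ⟨E, hE⟩ := D.exists_zeroExtend hU
    let lam : Fin i → X → ℝ := fun j x => E.D (fs (n x) j) x
    have hlam : ∀ j, Measurable (lam j) := fun j =>
      (measurable_from_prod_countable_right (f := fun p : ℕ × X => E.D (fs p.1 j) p.2)
        fun m => E.measurable_D _ (hfsL m j)).comp (hn.prodMk measurable_id)
    refine ⟨fun j u => lam j u, fun j => (hlam j).comp measurable_subtype_coe,
      fun j => ⟨E.C * 1, ?_⟩, fun f hf => ?_⟩
    · rw [ae_subMeasure_iff hU]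
      filter_upwards [ae_all_iff.2 fun m => E.abs_le_of_lipBound ((hF m).lipBound j)] with x hx _
      exact hx (n x)
    obtain ⟨F, hFL, hFf⟩ := hf.lipBound.exists_extension
    have hFL := hFL.isBddLipschitz
    have hfF : f = fun u : U => F u := funext fun u => (hFf u).symm
    have key : ∀ m, ∀ᵐ x ∂μ, x ∈ U ∩ n ⁻¹' {m} →
        E.D F x - ∑ j, E.D (fs m j) x * (Ds m j).D F x = 0 := fun m => by
      obtain ⟨S, hS⟩ := MDerivation.exists_sum_smul Finset.univ (Ds m)
        (lam := fun j => E.D (fs m j)) (fun j => E.measurable_D _ (hfsL m j))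
        fun j => ⟨_, E.abs_le_of_lipBound ((hF m).lipBound j)⟩
      obtain ⟨T, hT⟩ := E.exists_sub_smul S (lam := fun _ => 1) measurable_const
        ⟨1, by simp⟩
      simp only [one_mul, hS] at hT
      simp only [← hT]
      by_contra hcon
      have hUm : MeasurableSet (U ∩ n ⁻¹' {m}) := hU.inter (hn (measurableSet_singleton m))
      have hsub : U ∩ n ⁻¹' {m} ⊆ A m := fun x hx => by
        have h2 : n x = m := hx.2
        exact h2 ▸ hnA x hx.1
      have hFr : IsFrame (Ds m) (fs m) (U ∩ n ⁻¹' {m}) :=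
        ⟨(hF m).C_le, (hF m).lipBound, fun j k =>
          ((hF m).dual j k).mono fun x hx hxU => hx (hsub hxU)⟩
      obtain ⟨V, hVU, hV, hμV, hVF⟩ := hFr.exists_hasFrame_succ hUm T (fun k => by
        filter_upwards [ae_all_iff.2 fun j => hFr.dual j k] with x hx hxU
        rw [hT]
        simp [hx _ hxU]) hFL hcon
      exact hμV (hmax V (hVU.trans inter_subset_left) hV hVF)
    rw [ae_subMeasure_iff hU]
    filter_upwards [ae_all_iff.2 key, ae_all_iff.2 fun j => hRs j F hFL] with x h1 h2 hxU
    have h3 := sub_eq_zero.1 (h1 (n x) ⟨hxU, rfl⟩)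
    rw [hE, zeroExtend_of_mem hxU] at h3
    rw [hfF, h3]
    refine Finset.sum_congr rfl fun j _ => ?_
    rw [h2 j hxU, hG]

lemma HasFrame.exists_linIndepDer [SigmaFinite μ] {U : Set X} (hU : MeasurableSet U)
    (h : HasFrame μ i U) :
    ∃ Rs : Fin i → MDerivation U (subMeasure μ U), LinIndepDer (subMeasure μ U) Rs := by
  obtain ⟨Ds, fs, hF⟩ := h
  choose Rs hRs using fun j => (Ds j).exists_restrict hU
  refine ⟨Rs, linIndepDer_of_dual (fun _ => 0)
    (fun _ k => ((hF.lipBound k).isBddLipschitz).restrict U) fun m j k => ?_⟩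
  rw [ae_subMeasure_iff hU]
  filter_upwards [hRs j _ (hF.lipBound k).isBddLipschitz, hF.dual j k] with x h1 h2 hxU _
  rw [h1 hxU, h2 hxU]

end Frame

theorem stmt_14 {X : Type*} [MetricSpace X] [MeasurableSpace X] [BorelSpace X]
    (μ : Measure X) [SigmaFinite μ] (N : ℕ)
    (hloc : ∀ U : Set X, MeasurableSet U → 0 < μ U →
      ∀ (n : ℕ) (Ds : Fin n → MDerivation U (subMeasure μ U)),
        LinIndepDer (subMeasure μ U) Ds → n ≤ N) :
    ∃ (Xs : Fin (N + 1) → Set X) (Ω : Set X),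
      (∀ i, MeasurableSet (Xs i)) ∧ MeasurableSet Ω ∧
      Pairwise (Function.onFun Disjoint Xs) ∧ (∀ i, Disjoint (Xs i) Ω) ∧
      ((⋃ i, Xs i) ∪ Ω = univ) ∧ μ Ω = 0 ∧
      ∀ i : Fin (N + 1), (Xs i).Nonempty →
        ∃ Ds : Fin (i : ℕ) → MDerivation (Xs i) (subMeasure μ (Xs i)),
          LinIndepDer (subMeasure μ (Xs i)) Ds ∧
          ∀ D : MDerivation (Xs i) (subMeasure μ (Xs i)),
            ∃ lam : Fin (i : ℕ) → (Xs i) → ℝ,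
              (∀ j, Measurable (lam j)) ∧
              (∀ j, ∃ B : ℝ, ∀ᵐ x ∂(subMeasure μ (Xs i)), |lam j x| ≤ B) ∧
              ∀ f : (Xs i) → ℝ, IsBddLipschitz f →
                ∀ᵐ x ∂(subMeasure μ (Xs i)), D.D f x = ∑ j, lam j x * (Ds j).D f x := by
  choose A hAm hAF hAmax using fun i => exists_seq_maximal μ (hasFrame_empty μ i)
  let E : ℕ → Set X := fun i => ⋃ n, A i n
  have hE : ∀ i, MeasurableSet (E i) := fun i => MeasurableSet.iUnion (hAm i)
  let Xs : Fin (N + 1) → Set X := fun i => E i \ ⋃ j : Fin (N + 1), ⋃ _ : i < j, E j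
  have hXs : ∀ i, MeasurableSet (Xs i) := fun i => (hE i).diff
    (MeasurableSet.iUnion fun j => MeasurableSet.iUnion fun _ => hE j)
  have hlt : ∀ {i j : Fin (N + 1)}, i < j → Disjoint (Xs i) (E j) := fun {i j} hij =>
    disjoint_left.2 fun x hxi hxj => hxi.2 (mem_iUnion₂.2 ⟨j, hij, hxj⟩)
  have hcover : E 0 ⊆ ⋃ i, Xs i := fun x hx => by
    classical
    obtain ⟨i, hi, himax⟩ := Finset.exists_max_image
      (Finset.univ.filter fun i : Fin (N + 1) => x ∈ E i) id ⟨0, by simpa using hx⟩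
    refine mem_iUnion.2 ⟨i, (Finset.mem_filter.1 hi).2, fun hxj => ?_⟩
    obtain ⟨j, hij, hxj⟩ := mem_iUnion₂.1 hxj
    exact absurd (himax j (Finset.mem_filter.2 ⟨Finset.mem_univ j, hxj⟩)) (not_le.2 hij)
  refine ⟨Xs, (⋃ i, Xs i)ᶜ, hXs, (MeasurableSet.iUnion hXs).compl, fun i j hij => ?_,
    fun i => disjoint_compl_right.mono_left (subset_iUnion Xs i), union_compl_self _, ?_,
    fun i _ => ?_⟩
  · rcases lt_or_gt_of_ne hij with h | h
    · exact (hlt h).mono_right sdiff_subset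
    · exact ((hlt h).mono_right sdiff_subset).symm
  · exact measure_mono_null (compl_subset_compl.2 hcover)
      (hAmax 0 _ (hE 0).compl (hasFrame_zero μ _) disjoint_compl_left)
  · refine exists_basis_of_hasFrame (hAm i) (hAF i) (hXs i) sdiff_subset fun V hVX hV hVF => ?_
    rcases (Nat.le_of_lt_succ i.2).lt_or_eq with hi | hi
    · have hij : i < (⟨i + 1, Nat.succ_lt_succ hi⟩ : Fin (N + 1)) := Nat.lt_succ_self (i : ℕ)
      exact hAmax (i + 1) V hV hVF ((hlt hij).mono_left hVX)
    · by_contra hμ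
      obtain ⟨Rs, hRs⟩ := hVF.exists_linIndepDer hV
      have := hloc V hV (pos_iff_ne_zero.2 hμ) _ Rs hRs
      omega
end
end

section
/- Let (X,d,μ) be a complete doubling metric measure space, let X_α ⊆ X be measurable with μ(X_α) > 0, and let x^1,…,x^N be bounded Lipschitz functions on X_α forming a differentiable chart: for every bounded Lipschitz function f on X_α there exist unique (up to μ-null sets) measurable μ-essentially bounded functions ∂_1 f,…,∂_N f : X_α → ℝ with Lip(f − Σ_{j=1}^N ∂_j f(z)·x^j)(z) = 0 for μ-a.e. z ∈ X_α. Assume moreover that each map ∂_j : f ↦ ∂_j f is a derivation on (X_α,d,μ|_{X_α}). Then {∂_1,…,∂_N} is a basis of the module of derivations on X_α: the ∂_j are linearly independent over L∞(μ|_{X_α}), and every derivation D on X_α satisfies Df = Σ_{j=1}^N (D x^j)·(∂_j f) μ-a.e. on X_α for every bounded Lipschitz f on X_α. -/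
open MeasureTheory Metric Filter Set Topology
open scoped ENNReal NNReal

noncomputable section

section BddLipschitz

variable {Y : Type*} [PseudoMetricSpace Y]

lemma isBddLipschitz_iff {f : Y → ℝ} :
    IsBddLipschitz f ↔
      ∃ K : ℝ, 0 ≤ K ∧ (∀ x y, |f x - f y| ≤ K * dist x y) ∧ ∀ x, |f x| ≤ K := by
  constructor
  · rintro ⟨⟨K, hK⟩, M, hM⟩
    refine ⟨max K M, le_max_of_le_left K.2, fun x y => ?_, fun x => (hM x).trans (le_max_right _ _)⟩
    have h := hK.dist_le_mul x y
    rw [Real.dist_eq] at h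
    exact h.trans (mul_le_mul_of_nonneg_right (le_max_left _ _) dist_nonneg)
  · rintro ⟨K, hK, hL, hb⟩
    refine ⟨⟨⟨K, hK⟩, LipschitzWith.of_dist_le_mul fun x y => ?_⟩, K, hb⟩
    rw [Real.dist_eq]
    exact hL x y

lemma lipNorm_le {f : Y → ℝ} {M : ℝ} (hM : 0 ≤ M)
    (hL : ∀ x y, |f x - f y| ≤ M * dist x y) (hb : ∀ x, |f x| ≤ M) : lipNorm f ≤ M :=
  max_le (Real.iSup_le hb hM) (csInf_le ⟨0, fun _ h => h.1⟩ ⟨hM, hL⟩)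

lemma IsBddLipschitz.continuous {f : Y → ℝ} (hf : IsBddLipschitz f) : Continuous f :=
  hf.1.choose_spec.continuous

lemma IsBddLipschitz.const (c : ℝ) : IsBddLipschitz (fun _ : Y => c) :=
  ⟨⟨0, LipschitzWith.const c⟩, |c|, fun _ => le_rfl⟩

lemma IsBddLipschitz.linComb {f g : Y → ℝ} (a b : ℝ) (hf : IsBddLipschitz f)
    (hg : IsBddLipschitz g) : IsBddLipschitz (fun y => a * f y + b * g y) := by
  obtain ⟨K, hK, hL, hb⟩ := isBddLipschitz_iff.1 hf
  obtain ⟨K', hK', hL', hb'⟩ := isBddLipschitz_iff.1 hg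
  refine isBddLipschitz_iff.2 ⟨|a| * K + |b| * K', by positivity, fun x y => ?_, fun x => ?_⟩
  · calc |a * f x + b * g x - (a * f y + b * g y)|
        = |a * (f x - f y) + b * (g x - g y)| := by ring_nf
      _ ≤ |a| * |f x - f y| + |b| * |g x - g y| := by
        rw [← abs_mul, ← abs_mul]; exact abs_add_le _ _
      _ ≤ |a| * (K * dist x y) + |b| * (K' * dist x y) := by
        gcongr <;> apply_assumption
      _ = _ := by ring
  · calc |a * f x + b * g x| ≤ |a| * |f x| + |b| * |g x| := by
          rw [← abs_mul, ← abs_mul]; exact abs_add_le _ _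
      _ ≤ _ := by gcongr <;> apply_assumption

lemma IsBddLipschitz.sum {ι : Type*} (s : Finset ι) (c : ι → ℝ) {x : ι → Y → ℝ}
    (hx : ∀ j, IsBddLipschitz (x j)) : IsBddLipschitz (fun y => ∑ j ∈ s, c j * x j y) := by
  classical
  induction s using Finset.induction_on with
  | empty => simpa using IsBddLipschitz.const (Y := Y) 0
  | insert i s hi ih =>
    simp only [Finset.sum_insert hi]
    simpa using (hx i).linComb (c i) 1 ih

lemma IsBddLipschitz.comp_lipschitz {f : Y → ℝ} (hf : IsBddLipschitz f) {φ : ℝ → ℝ} {K : ℝ≥0}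
    (hφ : LipschitzWith K φ) : IsBddLipschitz (fun y => φ (f y)) := by
  obtain ⟨⟨L, hL⟩, M, hM⟩ := hf
  refine ⟨⟨K * L, hφ.comp hL⟩, |φ 0| + K * M, fun x => ?_⟩
  have h := hφ.dist_le_mul (f x) 0
  rw [Real.dist_eq, Real.dist_eq, sub_zero] at h
  have h1 : (K : ℝ) * |f x| ≤ K * M := mul_le_mul_of_nonneg_left (hM x) K.2
  have h2 := abs_sub_abs_le_abs_sub (φ (f x)) (φ 0)
  linarith

/-- A bounded Lipschitz function whose pointwise upper Lipschitz constant is below `t` at `z`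
satisfies the Lipschitz bound with constant `t` from `z` to nearby points. -/
lemma exists_ball_of_bigLip_lt {f : Y → ℝ} (hf : IsBddLipschitz f) {z : Y} {t : ℝ}
    (h : bigLip f z < t) :
    ∃ r > 0, ∀ y, dist y z < r → |f y - f z| ≤ t * dist y z := by
  obtain ⟨K, hK, hL, -⟩ := isBddLipschitz_iff.1 hf
  have : Nonempty (Ioi (0 : ℝ)) := ⟨⟨1, mem_Ioi.2 one_pos⟩⟩
  obtain ⟨⟨r, hr⟩, hrt⟩ := exists_lt_of_ciInf_lt h
  have hr0 : 0 < r := hr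
  have hbdd : ∀ s : ℝ, 0 < s → ∀ y ∈ ball z s, |f z - f y| ≤ K * s := fun s _ y hy =>
    (hL z y).trans (mul_le_mul_of_nonneg_left (by rw [dist_comm]; exact (mem_ball.1 hy).le) hK)
  have hvar : ∀ s : Ioc (0 : ℝ) r, varlip f z s.1 ≤ t := by
    intro s
    refine (le_ciSup (f := fun s : Ioc (0 : ℝ) r => varlip f z s.1) ?_ s).trans hrt.le
    refine ⟨K, ?_⟩
    rintro _ ⟨⟨s, hs⟩, rfl⟩
    have hsup : sSup ((fun y => |f z - f y|) '' ball z s) ≤ K * s := by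
      refine Real.sSup_le ?_ (mul_nonneg hK hs.1.le)
      rintro _ ⟨y, hy, rfl⟩
      exact hbdd s hs.1 y hy
    calc varlip f z s ≤ s⁻¹ * (K * s) :=
          mul_le_mul_of_nonneg_left hsup (inv_nonneg.2 hs.1.le)
      _ = K := by field_simp [hs.1.ne']
  refine ⟨r, hr0, fun y hy => ?_⟩
  have key : ∀ s ∈ Ioc (dist y z) r, |f y - f z| ≤ t * s := by
    intro s hs
    have hs0 : 0 < s := dist_nonneg.trans_lt hs.1
    have h1 : |f z - f y| ≤ sSup ((fun y => |f z - f y|) '' ball z s) := by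
      refine le_csSup ⟨K * s, ?_⟩ ⟨y, hs.1, rfl⟩
      rintro _ ⟨y, hy, rfl⟩
      exact hbdd s hs0 y hy
    have h2 := hvar ⟨s, hs0, hs.2⟩
    rw [abs_sub_comm, mul_comm]
    refine h1.trans ?_
    simpa [varlip, inv_mul_le_iff₀ hs0] using h2
  have hlim : Tendsto (fun s : ℝ => t * s) (𝓝[>] (dist y z)) (𝓝 (t * dist y z)) :=
    ((continuous_const.mul continuous_id).tendsto _).mono_left nhdsWithin_le_nhds
  exact ge_of_tendsto hlim (Filter.eventually_of_mem (Ioc_mem_nhdsGT hy) key)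

/-- If `g` is `t`-Lipschitz on a set `S` contained in the unit ball about `z₀ ∈ S`, then `g - g z₀`
extends from `S` to a `t`-Lipschitz function bounded by `t`. -/
lemma exists_lipschitz_extension_of_lipschitzOn {g : Y → ℝ} {S : Set Y} {t : ℝ} (ht : 0 ≤ t)
    {z₀ : Y} (hz₀ : z₀ ∈ S) (hdiam : ∀ x ∈ S, dist x z₀ ≤ 1)
    (hS : ∀ x ∈ S, ∀ y ∈ S, |g x - g y| ≤ t * dist x y) :
    ∃ h : Y → ℝ, (∀ x y, |h x - h y| ≤ t * dist x y) ∧ (∀ x, |h x| ≤ t) ∧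
      ∀ x ∈ S, h x = g x - g z₀ := by
  have hLip : LipschitzOnWith ⟨t, ht⟩ g S :=
    LipschitzOnWith.of_dist_le_mul fun x hx y hy => by rw [Real.dist_eq]; exact hS x hx y hy
  obtain ⟨k, hk, hkg⟩ := hLip.extend_real
  refine ⟨fun x => max (-t) (min (k x - g z₀) t), fun x y => ?_, fun x => ?_, fun x hx => ?_⟩
  · have hk' : |k x - k y| ≤ t * dist x y := by
      have := hk.dist_le_mul x y
      rwa [Real.dist_eq] at this
    refine le_trans ?_ hk'
    calc _ ≤ |min (k x - g z₀) t - min (k y - g z₀) t| := by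
          simpa using abs_max_sub_max_le_max (-t) (min (k x - g z₀) t) (-t) (min (k y - g z₀) t)
      _ ≤ |(k x - g z₀) - (k y - g z₀)| := by
          simpa using abs_min_sub_min_le_max (k x - g z₀) t (k y - g z₀) t
      _ = _ := by ring_nf
  · exact abs_le.2 ⟨le_max_left _ _, max_le (by linarith) (min_le_right _ _)⟩
  · have h1 : |g x - g z₀| ≤ t :=
      (hS x hx z₀ hz₀).trans (mul_le_of_le_one_right ht (hdiam x hx))
    rw [abs_le] at h1
    simp only [← hkg hx]
    rw [min_eq_left h1.2, max_eq_right h1.1]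

end BddLipschitz

namespace MDerivation

variable {Y : Type*} [PseudoMetricSpace Y] [MeasurableSpace Y] {ν : Measure Y}

lemma D_sum (D : MDerivation Y ν) {ι : Type*} (s : Finset ι) (c : ι → ℝ) {x : ι → Y → ℝ}
    (hx : ∀ j, IsBddLipschitz (x j)) :
    ∀ᵐ z ∂ν, D.D (fun y => ∑ j ∈ s, c j * x j y) z = ∑ j ∈ s, c j * D.D (x j) z := by
  classical
  induction s using Finset.induction_on with
  | empty =>
    have h := D.linear 0 0 (fun _ => 0) (fun _ => 0) (.const 0) (.const 0)
    simpa using h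
  | insert i s hi ih =>
    have h := D.linear (c i) 1 (x i) _ (hx i) (IsBddLipschitz.sum s c hx)
    simp only [one_mul] at h
    filter_upwards [h, ih] with z h1 h2
    simp only [Finset.sum_insert hi]
    rw [h1, h2]

lemma D_const (D : MDerivation Y ν) (c : ℝ) : ∀ᵐ z ∂ν, D.D (fun _ => c) z = 0 := by
  have h1 := D.leibniz (fun _ => 1) (fun _ => 1) (.const 1) (.const 1)
  have h2 := D.linear c 0 (fun _ => 1) (fun _ => 1) (.const 1) (.const 1)
  simp only [mul_one, zero_mul, add_zero] at h1 h2
  filter_upwards [h1, h2] with z h1 h2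
  rw [h2]
  have : D.D (fun _ => 1) z = 0 := by linarith
  simp [this]

/-- If `f = f * ψ`, then the derivation of `f` vanishes where both `f` and `ψ` do. -/
lemma D_eq_zero_of_mul_eq (D : MDerivation Y ν) {f ψ : Y → ℝ} (hf : IsBddLipschitz f)
    (hψ : IsBddLipschitz ψ) (h : ∀ y, f y * ψ y = f y) :
    ∀ᵐ z ∂ν, f z = 0 → ψ z = 0 → D.D f z = 0 := by
  have h1 := D.leibniz f ψ hf hψ
  simp only [h] at h1
  filter_upwards [h1] with z h1 hfz hψz
  rw [h1, hfz, hψz]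
  simp

/-- Locality: the derivation of `f` vanishes almost everywhere on the zero set of `f`. -/
lemma D_eq_zero_of_eq_zero [OpensMeasurableSpace Y] [SigmaFinite ν] (D : MDerivation Y ν)
    {f : Y → ℝ} (hf : IsBddLipschitz f) : ∀ᵐ z ∂ν, f z = 0 → D.D f z = 0 := by
  set ε : ℕ → ℝ := fun n => 1 / ((n : ℝ) + 1) with hε
  have hε0 : ∀ n, 0 < ε n := fun n => by positivity
  set φ : ℕ → ℝ → ℝ := fun n v => v - max (-ε n) (min v (ε n)) with hφ
  have hφ1 : ∀ n, LipschitzWith 1 (φ n) := fun n =>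
    LipschitzWith.of_dist_le_mul fun v w => by
      rw [Real.dist_eq, Real.dist_eq, NNReal.coe_one, one_mul]
      have := hε0 n
      simp only [hφ]
      rcases max_cases (-ε n) (min v (ε n)) with h1 | h1 <;>
      rcases min_cases v (ε n) with h2 | h2 <;>
      rcases max_cases (-ε n) (min w (ε n)) with h3 | h3 <;>
      rcases min_cases w (ε n) with h4 | h4 <;>
      rw [abs_le] <;>
      constructor <;>
      linarith [le_abs_self (v - w), neg_abs_le (v - w)]
  have hφ0 : ∀ n, φ n 0 = 0 := fun n => by
    simp [hφ, (hε0 n).le]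
  have hφsub : ∀ n v, |φ n v - v| ≤ ε n := fun n v => by
    have : φ n v - v = -max (-ε n) (min v (ε n)) := by simp [hφ]
    rw [this, abs_neg, abs_le]
    exact ⟨le_max_left _ _, max_le (by linarith [hε0 n]) (min_le_right _ _)⟩
  have hvan : ∀ n v, |v| ≤ ε n → φ n v = 0 := fun n v hv => by
    rw [abs_le] at hv
    simp [hφ, min_eq_left hv.2, max_eq_right hv.1]
  have hF : ∀ n, IsBddLipschitz (fun y => φ n (f y)) := fun n => hf.comp_lipschitz (hφ1 n)
  have hFzero : ∀ n, ∀ᵐ z ∂ν, f z = 0 → D.D (fun y => φ n (f y)) z = 0 := by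
    intro n
    have hψL : LipschitzWith (1 * ‖(ε n)⁻¹‖₊) fun v : ℝ => min ((ε n)⁻¹ * |v|) 1 := by
      have h1 : LipschitzWith (‖(ε n)⁻¹‖₊ * 1) fun v : ℝ => (ε n)⁻¹ * |v| :=
        (lipschitzWith_smul (ε n)⁻¹).comp (lipschitzWith_one_norm (E := ℝ))
      simpa using h1.min_const 1
    have h := D.D_eq_zero_of_mul_eq (hF n) (hf.comp_lipschitz hψL) (fun y => by
      rcases le_total |f y| (ε n) with h | h
      · rw [hvan n _ h, zero_mul]
      · rw [min_eq_right, mul_one]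
        rwa [le_inv_mul_iff₀ (hε0 n), mul_one])
    filter_upwards [h] with z hz hfz
    exact hz (by simp [hfz, hφ0]) (by simp [hfz])
  have hbound : ∃ B : ℝ, ∀ n, lipNorm (fun y => φ n (f y)) ≤ B := by
    obtain ⟨K, hK, hL, hb⟩ := isBddLipschitz_iff.1 hf
    refine ⟨K, fun n => lipNorm_le hK (fun x y => ?_) (fun x => ?_)⟩
    · have := (hφ1 n).dist_le_mul (f x) (f y)
      rw [Real.dist_eq, Real.dist_eq, NNReal.coe_one, one_mul] at this
      exact this.trans (hL x y)
    · have := (hφ1 n).dist_le_mul (f x) 0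
      rw [Real.dist_eq, Real.dist_eq, NNReal.coe_one, one_mul, hφ0, sub_zero, sub_zero] at this
      exact this.trans (hb x)
  have hlim : ∀ x, Tendsto (fun n => φ n (f x)) atTop (𝓝 (f x)) := fun x => by
    rw [tendsto_iff_dist_tendsto_zero]
    exact squeeze_zero (fun _ => dist_nonneg) (fun n => hφsub n (f x))
      tendsto_one_div_add_atTop_nhds_zero_nat
  have hmeas := D.measurable_D f hf
  have hzero : MeasurableSet {z | f z = 0} :=
    (isClosed_singleton.preimage hf.continuous).measurableSet
  have hpiece : ∀ k, ∀ᵐ z ∂ν, z ∈ spanningSets ν k → f z = 0 → D.D f z = 0 := by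
    intro k
    set A : Set Y := {z | f z = 0} ∩ spanningSets ν k with hA
    have hAm : MeasurableSet A := hzero.inter (measurableSet_spanningSets ν k)
    have hAfin : ν A < ⊤ :=
      (measure_mono inter_subset_right).trans_lt (measure_spanningSets_lt_top ν k)
    have hDA : IntegrableOn (D.D f) A ν :=
      Measure.integrableOn_of_bounded (M := D.C * lipNorm f) hAfin.ne hmeas.aestronglyMeasurable
        (ae_restrict_of_ae (D.bound f hf))
    have hw := D.weakStar _ f hF hf hbound hlim _ (hDA.integrable_indicator hAm)
    have hzeros : ∀ n, ∫ x, D.D (fun y => φ n (f y)) x * A.indicator (D.D f) x ∂ν = 0 := by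
      intro n
      refine integral_eq_zero_of_ae ?_
      filter_upwards [hFzero n] with z hz
      by_cases hzA : z ∈ A
      · simp [hz hzA.1]
      · simp [hzA]
    simp only [hzeros] at hw
    have hint : ∫ x, D.D f x * A.indicator (D.D f) x ∂ν = 0 :=
      tendsto_nhds_unique hw tendsto_const_nhds |>.symm ▸ rfl
    have hint2 : Integrable (fun x => D.D f x * A.indicator (D.D f) x) ν :=
      (hDA.integrable_indicator hAm).bdd_mul (c := D.C * lipNorm f) hmeas.aestronglyMeasurable
        (D.bound f hf)
    have hnn : ∀ x, 0 ≤ D.D f x * A.indicator (D.D f) x := fun x => by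
      by_cases hx : x ∈ A
      · simpa [hx] using mul_self_nonneg (D.D f x)
      · simp [hx]
    filter_upwards [(integral_eq_zero_iff_of_nonneg hnn hint2).1 hint] with z hz hzk hfz
    have hzA : z ∈ A := ⟨hfz, hzk⟩
    simpa [hzA] using hz
  filter_upwards [ae_all_iff.2 hpiece] with z hz hfz
  obtain ⟨k, hk⟩ := mem_iUnion.1 ((iUnion_spanningSets ν).symm ▸ mem_univ z)
  exact hz k hk hfz

/-- A derivation is controlled almost everywhere by the pointwise Lipschitz constant. -/
lemma abs_D_le_of_locally_lipschitz [OpensMeasurableSpace Y] [SigmaFinite ν]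
    [TopologicalSpace.SeparableSpace Y] (D : MDerivation Y ν) {g : Y → ℝ}
    (hg : IsBddLipschitz g) {t : ℝ} (ht : 0 ≤ t) :
    ∀ᵐ z ∂ν, (∃ r > 0, ∀ y, dist y z < r → |g y - g z| ≤ t * dist y z) →
      |D.D g z| ≤ D.C * t := by
  obtain ⟨Q, hQc, hQd⟩ := TopologicalSpace.exists_countable_dense Y
  have hpiece : ∀ n : ℕ, ∀ p ∈ Q, ∀ᵐ z ∂ν, dist z p < 1 / ((n : ℝ) + 1) / 2 →
      (∀ y, dist y z < 1 / ((n : ℝ) + 1) → |g y - g z| ≤ t * dist y z) →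
      |D.D g z| ≤ D.C * t := by
    intro n p _
    set ρ : ℝ := 1 / ((n : ℝ) + 1)
    have hρ : ρ ≤ 1 := (div_le_one (by positivity)).2 (by linarith [n.cast_nonneg (α := ℝ)])
    set S : Set Y := {z | dist z p < ρ / 2 ∧ ∀ y, dist y z < ρ → |g y - g z| ≤ t * dist y z}
    have hdiam : ∀ x ∈ S, ∀ y ∈ S, dist x y < ρ := fun x hx y hy => by
      linarith [dist_triangle_right x y p, hx.1, hy.1]
    rcases S.eq_empty_or_nonempty with hS | ⟨z₀, hz₀⟩
    · refine .of_forall fun z h1 h2 => ?_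
      exact absurd (show z ∈ S from ⟨h1, h2⟩) (hS ▸ notMem_empty z)
    obtain ⟨h, hL, hb, hSg⟩ := exists_lipschitz_extension_of_lipschitzOn ht hz₀
      (fun x hx => (hdiam x hx z₀ hz₀).le.trans hρ)
      (fun x hx y hy => hy.2 x (hdiam x hx y hy))
    have hh : IsBddLipschitz h := isBddLipschitz_iff.2 ⟨t, ht, hL, hb⟩
    have hgc := hg.linComb 1 (-g z₀) (.const 1)
    have hloc := D.D_eq_zero_of_eq_zero (hgc.linComb 1 (-1) hh)
    filter_upwards [hloc, D.linear 1 (-1) _ h hgc hh,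
      D.linear 1 (-g z₀) g (fun _ => 1) hg (.const 1), D.D_const 1, D.bound h hh]
      with z h1 h2 h3 h4 h5 hz1 hz2
    have h0 := h1 (by rw [hSg z ⟨hz1, hz2⟩]; ring)
    rw [h2, h3, h4] at h0
    have heq : D.D g z = D.D h z := by linarith
    rw [heq]
    exact h5.trans (mul_le_mul_of_nonneg_left (lipNorm_le ht hL hb) D.C_nonneg)
  have hall := ae_all_iff.2 fun n : ℕ => (ae_ball_iff hQc).2 fun p hp => hpiece n p hp
  filter_upwards [hall] with z hz
  rintro ⟨r, hr, hzr⟩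
  obtain ⟨n, hn⟩ := exists_nat_one_div_lt hr
  obtain ⟨p, hpQ, hp⟩ := hQd.exists_dist_lt z (show 0 < 1 / ((n : ℝ) + 1) / 2 by positivity)
  exact hz n p hpQ hp fun y hy => hzr y (hy.trans hn)

end MDerivation

/-- A space carrying a σ-finite measure that is positive on balls is separable. -/
lemma separableSpace_of_measure_ball_pos {X : Type*} [MetricSpace X] [MeasurableSpace X]
    [OpensMeasurableSpace X] (μ : Measure X) [SigmaFinite μ]
    (hpos : ∀ (x : X) (r : ℝ), 0 < r → 0 < μ (ball x r)) :
    TopologicalSpace.SeparableSpace X := by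
  suffices SecondCountableTopology X from inferInstance
  refine Metric.secondCountable_of_almost_dense_set fun ε hε => ?_
  obtain ⟨S, hS⟩ := zorn_subset {S : Set X | S.Pairwise fun x y => ε ≤ dist x y} (by
    intro c hc hchain
    refine ⟨⋃₀ c, ?_, fun s hs => subset_sUnion_of_mem hs⟩
    exact (pairwise_sUnion hchain.directedOn).2 fun s hs => hc hs)
  refine ⟨S, ?_, fun x => ?_⟩
  · have hdisj : Pairwise (Function.onFun Disjoint fun x : S => ball (x : X) (ε / 2)) :=
      fun x y hxy => ball_disjoint_ball (by
        linarith [hS.prop x.2 y.2 (fun h => hxy (Subtype.ext h))])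
    have := Measure.countable_meas_pos_of_disjoint_iUnion (μ := μ)
      (fun x : S => (isOpen_ball (x := (x : X)) (ε := ε / 2)).measurableSet) hdisj
    have huniv : {x : S | 0 < μ (ball (x : X) (ε / 2))} = univ :=
      eq_univ_of_forall fun x => hpos x _ (half_pos hε)
    rw [huniv, countable_univ_iff] at this
    exact this
  · by_contra! hcon
    have hins : insert x S ⊆ S := hS.le_of_ge
      (hS.prop.insert fun y hy _ => ⟨(hcon y hy).le, dist_comm x y ▸ (hcon y hy).le⟩)
      (subset_insert x S)
    have := hcon x (hins (mem_insert x S))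
    rw [dist_self] at this
    linarith

lemma sigmaFinite_of_measure_ball_lt_top {X : Type*} [PseudoMetricSpace X] [MeasurableSpace X]
    (μ : Measure X) (hfin : ∀ (x : X) (r : ℝ), 0 < r → μ (ball x r) < ⊤) : SigmaFinite μ := by
  rcases isEmpty_or_nonempty X with _ | ⟨⟨x⟩⟩
  · rw [Measure.eq_zero_of_isEmpty μ]
    infer_instance
  refine ⟨⟨⟨fun n : ℕ => ball x (n + 1), fun _ => trivial,
    fun n => hfin x _ (by positivity), ?_⟩⟩⟩
  refine eq_univ_of_forall fun y => mem_iUnion.2 ?_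
  obtain ⟨n, hn⟩ := exists_nat_gt (dist y x)
  exact ⟨n, by rw [mem_ball]; linarith⟩

lemma sigmaFinite_subMeasure {X : Type*} [PseudoMetricSpace X] [MeasurableSpace X]
    {μ : Measure X} (hfin : ∀ (x : X) (r : ℝ), 0 < r → μ (ball x r) < ⊤) {s : Set X}
    (hs : MeasurableSet s) : SigmaFinite (subMeasure μ s) := by
  refine sigmaFinite_of_measure_ball_lt_top _ fun x r hr => ?_
  rw [subMeasure, (MeasurableEmbedding.subtype_coe hs).comap_apply]
  refine (measure_mono ?_).trans_lt (hfin x r hr)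
  rintro _ ⟨y, hy, rfl⟩
  exact hy

lemma bigLip_zero {Y : Type*} [PseudoMetricSpace Y] (z : Y) : bigLip (fun _ => (0 : ℝ)) z = 0 := by
  have h : ∀ s, varlip (fun _ : Y => (0 : ℝ)) z s = 0 := fun s => by
    have : sSup ((fun _ : Y => |(0 : ℝ) - 0|) '' ball z s) = 0 := by
      refine le_antisymm (Real.sSup_nonpos ?_) (Real.sSup_nonneg ?_) <;>
      · rintro _ ⟨y, -, rfl⟩
        simp
    rw [varlip, this, mul_zero]
  simp [bigLip, bigLipR, h]

theorem stmt_16 {X : Type*} [MetricSpace X] [CompleteSpace X]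
    [MeasurableSpace X] [BorelSpace X] (μ : Measure X) (hμ : μ ≠ 0)
    (hpos : ∀ (x : X) (r : ℝ), 0 < r → 0 < μ (ball x r))
    (hfin : ∀ (x : X) (r : ℝ), 0 < r → μ (ball x r) < ⊤)
    (CD : ℝ≥0∞) (hCD : 1 ≤ CD)
    (hdoub : ∀ (x : X) (r : ℝ), 0 < r → μ (ball x (2 * r)) ≤ CD * μ (ball x r))
    (Xα : Set X) (hXα : MeasurableSet Xα) (hXαpos : 0 < μ Xα)
    {N : ℕ} (xs : Fin N → Xα → ℝ) (hxs : ∀ j, IsBddLipschitz (xs j))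
    (pd : Fin N → MDerivation Xα (subMeasure μ Xα))
    (hchart : ∀ f : Xα → ℝ, IsBddLipschitz f → ∀ᵐ z ∂(subMeasure μ Xα),
      bigLip (fun y => f y - ∑ j, (pd j).D f z * xs j y) z = 0)
    (hunique : ∀ f : Xα → ℝ, IsBddLipschitz f → ∀ b : Fin N → Xα → ℝ,
      (∀ j, Measurable (b j)) → (∀ j, ∃ B : ℝ, ∀ᵐ z ∂(subMeasure μ Xα), |b j z| ≤ B) →
      (∀ᵐ z ∂(subMeasure μ Xα), bigLip (fun y => f y - ∑ j, b j z * xs j y) z = 0) →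
      ∀ j, ∀ᵐ z ∂(subMeasure μ Xα), b j z = (pd j).D f z) :
    LinIndepDer (subMeasure μ Xα) pd ∧
    ∀ D : MDerivation Xα (subMeasure μ Xα), ∀ f : Xα → ℝ, IsBddLipschitz f →
      ∀ᵐ z ∂(subMeasure μ Xα), D.D f z = ∑ j, D.D (xs j) z * (pd j).D f z := by
  have : SigmaFinite μ := sigmaFinite_of_measure_ball_lt_top μ hfin
  have : SigmaFinite (subMeasure μ Xα) := sigmaFinite_subMeasure hfin hXα
  have := separableSpace_of_measure_ball_pos μ hpos
  have := UniformSpace.secondCountable_of_separable X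
  constructor
  · intro lam _ _ hlam i
    have hdelta : ∀ j, ∀ᵐ z ∂(subMeasure μ Xα), (if j = i then (1 : ℝ) else 0) = (pd j).D (xs i) z :=
      hunique (xs i) (hxs i) (fun j _ => if j = i then 1 else 0) (fun _ => measurable_const)
        (fun j => ⟨1, .of_forall fun _ => by split_ifs <;> simp⟩)
        (.of_forall fun z => by simpa using bigLip_zero z)
    filter_upwards [hlam (xs i) (hxs i), ae_all_iff.2 hdelta] with z h1 h2
    simpa [← h2] using h1
  · intro D f hf
    choose K hK hL _ using fun j => isBddLipschitz_iff.1 (hxs j)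
    have hcomb : ∀ c : Fin N → ℝ, IsBddLipschitz fun y => f y - ∑ j, c j * xs j y := fun c => by
      simpa [sub_eq_add_neg] using hf.linComb 1 (-1) (IsBddLipschitz.sum Finset.univ c hxs)
    have hDcomb : ∀ q : Fin N → ℚ, ∀ᵐ z ∂(subMeasure μ Xα),
        D.D (fun y => f y - ∑ j, (q j : ℝ) * xs j y) z
          = D.D f z - ∑ j, (q j : ℝ) * D.D (xs j) z := by
      intro q
      filter_upwards [D.linear 1 (-1) f _ hf (IsBddLipschitz.sum Finset.univ (fun j => (q j : ℝ)) hxs),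
        D.D_sum Finset.univ (fun j => (q j : ℝ)) hxs] with z h1 h2
      rw [h2] at h1
      simpa [sub_eq_add_neg] using h1
    have hbd := ae_all_iff.2 fun q : Fin N → ℚ => ae_all_iff.2 fun n : ℕ =>
      D.abs_D_le_of_locally_lipschitz (hcomb fun j => (q j : ℝ))
        (show 0 ≤ 1 / ((n : ℝ) + 1) by positivity)
    filter_upwards [hchart f hf, ae_all_iff.2 hDcomb, hbd] with z hz hD hb
    set a : Fin N → ℝ := fun j => (pd j).D f z
    have key : ∀ n : ℕ, |D.D f z - ∑ j, D.D (xs j) z * a j| ≤ (D.C + 1) * (1 / ((n : ℝ) + 1)) := by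
      intro n
      set t : ℝ := 1 / ((n : ℝ) + 1)
      have ht : 0 < t := by positivity
      set M : ℝ := 1 + ∑ j, K j + ∑ j, |D.D (xs j) z|
      have hsK : 0 ≤ ∑ j, K j := Finset.sum_nonneg fun j _ => hK j
      have hsD : 0 ≤ ∑ j, |D.D (xs j) z| := Finset.sum_nonneg fun j _ => abs_nonneg _
      have hM : 0 < M := by positivity
      set δ : ℝ := t / 2 / M
      have hδ : 0 < δ := by positivity
      have hδM : δ * M = t / 2 := div_mul_cancel₀ _ hM.ne'
      have hδK : δ * ∑ j, K j ≤ t / 2 := by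
        rw [← hδM]; exact mul_le_mul_of_nonneg_left (by simp only [M]; linarith) hδ.le
      have hδD : δ * ∑ j, |D.D (xs j) z| ≤ t := by
        have : δ * ∑ j, |D.D (xs j) z| ≤ t / 2 := by
          rw [← hδM]; exact mul_le_mul_of_nonneg_left (by simp only [M]; linarith) hδ.le
        linarith
      have hq : ∀ j, ∃ q : ℚ, |a j - q| ≤ δ := fun j => (exists_rat_near (a j) hδ).imp fun _ h => h.le
      choose q hq using hq
      have hlin : ∀ (u : Fin N → ℝ), |∑ j, (a j - q j) * u j| ≤ δ * ∑ j, |u j| := fun u => by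
        rw [Finset.mul_sum]
        refine (Finset.abs_sum_le_sum_abs _ _).trans (Finset.sum_le_sum fun j _ => ?_)
        rw [abs_mul]
        exact mul_le_mul_of_nonneg_right (hq j) (abs_nonneg _)
      have hloc : ∃ r > 0, ∀ y, dist y z < r →
          |(f y - ∑ j, (q j : ℝ) * xs j y) - (f z - ∑ j, (q j : ℝ) * xs j z)| ≤ t * dist y z := by
        obtain ⟨r, hr, hrz⟩ := exists_ball_of_bigLip_lt (hcomb a) (hz.trans_lt (half_pos ht))
        refine ⟨r, hr, fun y hy => ?_⟩
        have hsum : |∑ j, (a j - q j) * (xs j y - xs j z)| ≤ t / 2 * dist y z := by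
          refine (hlin _).trans ?_
          calc δ * ∑ j, |xs j y - xs j z| ≤ δ * ∑ j, K j * dist y z := by
                gcongr with j; exact hL j y z
            _ = (δ * ∑ j, K j) * dist y z := by rw [← Finset.sum_mul, mul_assoc]
            _ ≤ _ := mul_le_mul_of_nonneg_right hδK dist_nonneg
        have hsplit : (f y - ∑ j, (q j : ℝ) * xs j y) - (f z - ∑ j, (q j : ℝ) * xs j z)
            = ((f y - ∑ j, a j * xs j y) - (f z - ∑ j, a j * xs j z))
              + ∑ j, (a j - q j) * (xs j y - xs j z) := by
          simp only [sub_mul, mul_sub, Finset.sum_sub_distrib]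
          ring
        rw [hsplit]
        refine (abs_add_le _ _).trans ?_
        linarith [hrz y hy]
      have h1 := hb q n hloc
      rw [hD q] at h1
      have hsplit : D.D f z - ∑ j, D.D (xs j) z * a j
          = (D.D f z - ∑ j, (q j : ℝ) * D.D (xs j) z) - ∑ j, (a j - q j) * D.D (xs j) z := by
        simp only [sub_mul, Finset.sum_sub_distrib, mul_comm (D.D _ z)]
        ring
      rw [hsplit]
      refine (abs_sub _ _).trans ?_
      linarith [hlin fun j => D.D (xs j) z]
    have hlim : Tendsto (fun n : ℕ => (D.C + 1) * (1 / ((n : ℝ) + 1))) atTop (𝓝 0) := by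
      simpa using (tendsto_one_div_add_atTop_nhds_zero_nat (𝕜 := ℝ)).const_mul (D.C + 1)
    have h0 := ge_of_tendsto' hlim key
    exact sub_eq_zero.1 (abs_nonpos_iff.1 h0)
end
end
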